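/- arXiv:2205.04451 — 3 statements merged into one kernel-verified Lean document; each statement's English description precedes it below -/
import Mathlib

section
/- For every α ∈ (0,1), the improper integral ∫_0^∞ s^{−α−1} sin(s) ds exists (as the limit of ∫_0^T s^{−α−1} sin(s) ds as T → ∞) and equals π/(2 cos(απ/2) Γ(1+α)). -/
open MeasureTheory Real Filter

/-- The function `s ^ (-α - 1) * sin s` is absolutely integrable on `(0, ∞)`. -/
theorem integrableOn_rpow_mul_sin {α : ℝ} (h0 : 0 < α) (h1 : α < 1) :
    IntegrableOn (fun s : ℝ => s ^ (-α - 1) * sin s) (Set.Ioi 0) := by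
  have hmeas : Measurable fun s : ℝ => s ^ (-α - 1) * sin s := by fun_prop
  rw [← Set.Ioc_union_Ioi_eq_Ioi zero_le_one]
  refine IntegrableOn.union ?_ ?_
  · have hg : IntegrableOn (fun s : ℝ => s ^ (-α)) (Set.Ioc 0 1) :=
      (intervalIntegrable_iff_integrableOn_Ioc_of_le zero_le_one).1
        (intervalIntegral.intervalIntegrable_rpow' (by linarith))
    refine Integrable.mono' hg hmeas.aestronglyMeasurable ?_
    filter_upwards [ae_restrict_mem measurableSet_Ioc] with s hs
    have hs0 : 0 < s := hs.1
    calc ‖s ^ (-α - 1) * sin s‖ = s ^ (-α - 1) * |sin s| := by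
          rw [norm_mul, norm_of_nonneg (by positivity), norm_eq_abs]
      _ ≤ s ^ (-α - 1) * s := by
          gcongr
          simpa [abs_of_pos hs0] using abs_sin_le_abs (x := s)
      _ = s ^ (-α) := by
          rw [← rpow_add_one hs0.ne']
          ring_nf
  · refine Integrable.mono' (integrableOn_Ioi_rpow_of_lt (by linarith : -α - 1 < -1) one_pos)
      hmeas.aestronglyMeasurable ?_
    filter_upwards [ae_restrict_mem measurableSet_Ioi] with s hs
    have hs0 : 0 < s := one_pos.trans hs
    rw [norm_mul, norm_of_nonneg (by positivity), norm_eq_abs]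
    exact mul_le_of_le_one_right (by positivity) (abs_sin_le_one s)

/-- The Laplace transform of the sine function. -/
theorem integral_exp_neg_mul_mul_sin {t : ℝ} (ht : 0 < t) :
    ∫ s in Set.Ioi (0 : ℝ), exp (-(s * t)) * sin s = (1 + t ^ 2)⁻¹ := by
  have hexp : IntegrableOn (fun s : ℝ => exp (-(s * t))) (Set.Ioi 0) := by
    simpa [mul_comm] using exp_neg_integrableOn_Ioi 0 ht
  have hsin : IntegrableOn (fun s : ℝ => exp (-(s * t)) * sin s) (Set.Ioi 0) := by
    refine Integrable.mono' hexp (by fun_prop) (Eventually.of_forall fun s => ?_)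
    rw [norm_mul, norm_of_nonneg (by positivity), norm_eq_abs]
    exact mul_le_of_le_one_right (by positivity) (abs_sin_le_one s)
  have hderiv : ∀ s ∈ Set.Ici (0 : ℝ),
      HasDerivAt (fun s => -(exp (-(s * t)) * ((t * sin s + cos s) / (1 + t ^ 2))))
        (exp (-(s * t)) * sin s) s := by
    intro s _
    have hE : HasDerivAt (fun s => exp (-(s * t))) (exp (-(s * t)) * -(1 * t)) s :=
      ((hasDerivAt_id s).mul_const t).neg.exp
    have hT : HasDerivAt (fun s => (t * sin s + cos s) / (1 + t ^ 2))
        ((t * cos s + -sin s) / (1 + t ^ 2)) s :=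
      (((hasDerivAt_sin s).const_mul t).add (hasDerivAt_cos s)).div_const _
    refine (hE.mul hT).neg.congr_deriv ?_
    field_simp
    ring
  have hlim : Tendsto (fun s => -(exp (-(s * t)) * ((t * sin s + cos s) / (1 + t ^ 2)))) atTop
      (nhds 0) := by
    have hE : Tendsto (fun s : ℝ => exp (-(s * t))) atTop (nhds 0) :=
      tendsto_exp_neg_atTop_nhds_zero.comp (tendsto_id.atTop_mul_const ht)
    have hB : IsBoundedUnder (· ≤ ·) atTop
        (norm ∘ fun s : ℝ => (t * sin s + cos s) / (1 + t ^ 2)) := by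
      refine isBoundedUnder_of ⟨(t + 1) / (1 + t ^ 2), fun s => ?_⟩
      rw [Function.comp_apply, norm_div, norm_of_nonneg (by positivity : 0 ≤ 1 + t ^ 2)]
      gcongr
      refine (norm_add_le _ _).trans ?_
      rw [norm_mul, norm_of_nonneg ht.le]
      exact add_le_add (mul_le_of_le_one_right ht.le (abs_sin_le_one s)) (abs_cos_le_one s)
    simpa using (hE.zero_mul_isBoundedUnder_le hB).neg
  rw [integral_Ioi_of_hasDerivAt_of_tendsto' hderiv hsin hlim]
  simp

/-- The integral `∫₀^∞ t ^ α / (1 + t ^ 2) dt`. -/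
theorem integral_rpow_mul_inv_one_add_sq {α : ℝ} (h0 : -1 < α) (h1 : α < 1) :
    ∫ t in Set.Ioi (0 : ℝ), t ^ α * (1 + t ^ 2)⁻¹ = π / (2 * cos (α * π / 2)) := by
  have hinner : ∀ u ∈ Set.Ioi (0 : ℝ),
      ∫ t in Set.Ioi (0 : ℝ), t ^ α * exp (-(u * (1 + t ^ 2))) =
        (1 / 2 * Gamma ((α + 1) / 2)) * (exp (-u) * u ^ ((1 - α) / 2 - 1)) := by
    intro u hu
    have h := integral_rpow_mul_exp_neg_mul_rpow two_pos h0 hu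
    simp only [rpow_two] at h
    have hsplit : ∀ t : ℝ, t ^ α * exp (-(u * (1 + t ^ 2))) =
        exp (-u) * (t ^ α * exp (-u * t ^ 2)) := fun t => by
      rw [mul_left_comm, ← exp_add]
      ring_nf
    simp_rw [hsplit]
    rw [integral_const_mul, h, show -(α + 1) / 2 = (1 - α) / 2 - 1 by ring]
    ring
  have hprod : Integrable (Function.uncurry fun u t : ℝ => t ^ α * exp (-(u * (1 + t ^ 2))))
      ((volume.restrict (Set.Ioi 0)).prod (volume.restrict (Set.Ioi 0))) := by
    rw [integrable_prod_iff (by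
      refine Measurable.aestronglyMeasurable ?_
      unfold Function.uncurry
      fun_prop)]
    constructor
    · filter_upwards [ae_restrict_mem measurableSet_Ioi] with u hu
      refine ((integrableOn_rpow_mul_exp_neg_mul_sq hu h0).const_mul (exp (-u))).congr
        (Eventually.of_forall fun t => ?_)
      simp only [Function.uncurry_apply_pair]
      rw [mul_left_comm, ← exp_add]
      ring_nf
    · refine Integrable.congr ((GammaIntegral_convergent (by linarith : 0 < (1 - α) / 2)).const_mul
        (1 / 2 * Gamma ((α + 1) / 2))) ?_
      filter_upwards [ae_restrict_mem measurableSet_Ioi] with u hu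
      rw [← hinner u hu]
      refine setIntegral_congr_fun measurableSet_Ioi fun t ht => ?_
      have ht0 : 0 < t := ht
      exact (norm_of_nonneg (by positivity : 0 ≤ t ^ α * exp (-(u * (1 + t ^ 2))))).symm
  calc ∫ t in Set.Ioi (0 : ℝ), t ^ α * (1 + t ^ 2)⁻¹
      = ∫ t in Set.Ioi (0 : ℝ), ∫ u in Set.Ioi (0 : ℝ), t ^ α * exp (-(u * (1 + t ^ 2))) := by
        refine setIntegral_congr_fun measurableSet_Ioi fun t _ => ?_
        have h := integral_rpow_mul_exp_neg_mul_Ioi one_pos (by positivity : 0 < 1 + t ^ 2)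
        simp only [sub_self, rpow_zero, one_mul, rpow_one, Gamma_one, mul_one, one_div] at h
        simp only [integral_const_mul]
        simp_rw [← h, mul_comm (1 + t ^ 2)]
    _ = ∫ u in Set.Ioi (0 : ℝ), ∫ t in Set.Ioi (0 : ℝ), t ^ α * exp (-(u * (1 + t ^ 2))) :=
        (integral_integral_swap hprod).symm
    _ = 1 / 2 * (Gamma ((α + 1) / 2) * Gamma ((1 - α) / 2)) := by
        rw [setIntegral_congr_fun measurableSet_Ioi hinner, integral_const_mul,
          ← Gamma_eq_integral (by linarith)]
        ring
    _ = π / (2 * cos (α * π / 2)) := by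
        rw [show (1 - α) / 2 = 1 - (α + 1) / 2 by ring, Gamma_mul_Gamma_one_sub,
          show π * ((α + 1) / 2) = α * π / 2 + π / 2 by ring, sin_add_pi_div_two]
        field_simp

/-- The absolutely convergent integral `∫₀^∞ s ^ (-α - 1) * sin s ds`. -/
theorem integral_rpow_mul_sin {α : ℝ} (h0 : 0 < α) (h1 : α < 1) :
    ∫ s in Set.Ioi (0 : ℝ), s ^ (-α - 1) * sin s =
      π / (2 * cos (α * π / 2) * Gamma (1 + α)) := by
  have hΓ : 0 < Gamma (1 + α) := Gamma_pos_of_pos (by linarith)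
  have hkernel : ∀ s ∈ Set.Ioi (0 : ℝ),
      ∫ t in Set.Ioi (0 : ℝ), t ^ α * exp (-(s * t)) = Gamma (1 + α) * s ^ (-α - 1) := by
    intro s hs
    have h := integral_rpow_mul_exp_neg_mul_Ioi (by linarith : 0 < 1 + α) hs
    rw [add_sub_cancel_left] at h
    rw [h, one_div, inv_rpow (le_of_lt hs), ← rpow_neg (le_of_lt hs), mul_comm]
    ring_nf
  have hprod : Integrable (Function.uncurry fun s t : ℝ => t ^ α * exp (-(s * t)) * sin s)
      ((volume.restrict (Set.Ioi 0)).prod (volume.restrict (Set.Ioi 0))) := by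
    rw [integrable_prod_iff (by
      refine Measurable.aestronglyMeasurable ?_
      unfold Function.uncurry
      fun_prop)]
    constructor
    · filter_upwards [ae_restrict_mem measurableSet_Ioi] with s hs
      have h := integrableOn_rpow_mul_exp_neg_mul_rpow (by linarith : -1 < α) one_pos hs
      simp only [rpow_one, neg_mul] at h
      exact h.mul_const (sin s)
    · refine Integrable.congr
        ((integrableOn_rpow_mul_sin h0 h1).norm.const_mul (Gamma (1 + α))) ?_
      filter_upwards [ae_restrict_mem measurableSet_Ioi] with s hs
      have hs0 : 0 < s := hs
      rw [norm_mul, norm_of_nonneg (by positivity : 0 ≤ s ^ (-α - 1)), ← mul_assoc,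
        ← hkernel s hs, ← integral_mul_const]
      refine setIntegral_congr_fun measurableSet_Ioi fun t ht => ?_
      have ht0 : 0 < t := ht
      simp only [Function.uncurry_apply_pair]
      rw [norm_mul _ (sin s), norm_of_nonneg (by positivity : 0 ≤ t ^ α * exp (-(s * t)))]
  have hswap : Gamma (1 + α) * ∫ s in Set.Ioi (0 : ℝ), s ^ (-α - 1) * sin s =
      π / (2 * cos (α * π / 2)) := by
    rw [← integral_const_mul, ← integral_rpow_mul_inv_one_add_sq (by linarith) h1]
    calc ∫ s in Set.Ioi (0 : ℝ), Gamma (1 + α) * (s ^ (-α - 1) * sin s)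
        = ∫ s in Set.Ioi (0 : ℝ), ∫ t in Set.Ioi (0 : ℝ), t ^ α * exp (-(s * t)) * sin s := by
          refine setIntegral_congr_fun measurableSet_Ioi fun s hs => ?_
          simp only [integral_mul_const]
          rw [hkernel s hs, mul_assoc]
      _ = ∫ t in Set.Ioi (0 : ℝ), ∫ s in Set.Ioi (0 : ℝ), t ^ α * exp (-(s * t)) * sin s :=
          integral_integral_swap hprod
      _ = ∫ t in Set.Ioi (0 : ℝ), t ^ α * (1 + t ^ 2)⁻¹ := by
          refine setIntegral_congr_fun measurableSet_Ioi fun t ht => ?_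
          simp only [mul_assoc, integral_const_mul]
          rw [integral_exp_neg_mul_mul_sin ht]
  rw [← div_div, ← hswap, mul_div_cancel_left₀ _ hΓ.ne']

/-- For every `α ∈ (0,1)`, the improper integral `∫_0^∞ s^{-α-1} sin s ds`
exists (as the limit of `∫_0^T` as `T → ∞`) and equals `π/(2 cos(απ/2) Γ(1+α))`. -/
theorem stmt1 (α : ℝ) (h0 : 0 < α) (h1 : α < 1) :
    Tendsto (fun T : ℝ => ∫ s in (0:ℝ)..T, s ^ (-α - 1) * Real.sin s) atTop
      (nhds (π / (2 * Real.cos (α * π / 2) * Real.Gamma (1 + α)))) := by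
  rw [← integral_rpow_mul_sin h0 h1]
  exact intervalIntegral_tendsto_integral_Ioi 0 (integrableOn_rpow_mul_sin h0 h1) tendsto_id
end

section
/- For every α ∈ (0,2), the integral ∫_0^∞ (1 − J₀(s)) s^{−1−α} ds converges absolutely and equals 2^{−α} Γ(1−α/2) / (α Γ(1+α/2)). -/
open MeasureTheory Real

/-- The Bessel function of the first kind of order 0:
`J₀(s) = (1/π) ∫_0^π cos(s sin θ) dθ`. -/
noncomputable def J0 (s : ℝ) : ℝ := (1 / π) * ∫ θ in (0:ℝ)..π, Real.cos (s * Real.sin θ)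

/-- Fubini for a nonnegative kernel: integrability of one iterated integral gives integrability of
the other, and their equality. -/
theorem integral_swap_of_nonneg {S T : Set ℝ} (hS : MeasurableSet S) (hT : MeasurableSet T)
    {F : ℝ → ℝ → ℝ} (hF : Measurable (Function.uncurry F))
    (hnn : ∀ x ∈ S, ∀ y ∈ T, 0 ≤ F x y)
    (hint : ∀ y ∈ T, IntegrableOn (fun x => F x y) S)
    (hH : IntegrableOn (fun y => ∫ x in S, F x y) T) :
    IntegrableOn (fun x => ∫ y in T, F x y) S ∧
      ∫ x in S, ∫ y in T, F x y = ∫ y in T, ∫ x in S, F x y := by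
  have hprod : Integrable (Function.uncurry F)
      ((volume.restrict S).prod (volume.restrict T)) := by
    rw [integrable_prod_iff' hF.aestronglyMeasurable]
    refine ⟨(ae_restrict_iff' hT).2 (.of_forall hint), ?_⟩
    refine IntegrableOn.congr_fun hH (fun y hy => ?_) hT
    refine setIntegral_congr_fun hS fun x hx => ?_
    exact (norm_of_nonneg (hnn x hx y hy)).symm
  exact ⟨hprod.integral_prod_left, integral_integral_swap hprod⟩

theorem integral_rpow_mul_exp_neg_div {β x : ℝ} (hβ : β < 1) (hx : 0 < x) :
    IntegrableOn (fun t : ℝ => t ^ (β - 2) * exp (-(x / t))) (Set.Ioi 0) ∧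
    ∫ t in Set.Ioi (0:ℝ), t ^ (β - 2) * exp (-(x / t)) = Gamma (1 - β) * x ^ (β - 1) := by
  have key : ∀ t ∈ Set.Ioi (0:ℝ), (|(-1:ℝ)| * t ^ ((-1:ℝ) - 1)) •
      ((fun u : ℝ => u ^ ((1 - β) - 1) * exp (-(x * u))) (t ^ (-1:ℝ))) =
      t ^ (β - 2) * exp (-(x / t)) := by
    intro t ht
    have ht : 0 < t := ht
    simp only [smul_eq_mul, abs_neg, abs_one, one_mul]
    rw [← rpow_mul ht.le, ← mul_assoc, ← rpow_add ht, rpow_neg_one, ← div_eq_mul_inv]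
    ring_nf
  constructor
  · have h : IntegrableOn (fun u : ℝ => u ^ ((1 - β) - 1) * exp (-(x * u))) (Set.Ioi 0) := by
      have := integrableOn_rpow_mul_exp_neg_mul_rpow (p := 1) (s := 1 - β - 1) (b := x)
        (by linarith) one_pos hx
      simpa [neg_mul] using this
    exact ((integrableOn_Ioi_comp_rpow_iff _ (p := -1) (by norm_num)).2 h).congr_fun key
      measurableSet_Ioi
  · rw [← setIntegral_congr_fun measurableSet_Ioi key,
      integral_comp_rpow_Ioi (fun u : ℝ => u ^ ((1 - β) - 1) * exp (-(x * u))) (p := -1)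
        (by norm_num), integral_rpow_mul_exp_neg_mul_Ioi (by linarith) hx, mul_comm, one_div,
      ← rpow_neg_one, ← rpow_mul hx.le]
    ring_nf

theorem integral_rpow_mul_one_sub_exp_neg_div {β c : ℝ} (h0 : 0 < β) (h1 : β < 1) (hc : 0 < c) :
    IntegrableOn (fun t : ℝ => t ^ (β - 1) * (1 - exp (-(c / t)))) (Set.Ioi 0) ∧
    ∫ t in Set.Ioi (0:ℝ), t ^ (β - 1) * (1 - exp (-(c / t))) =
      Gamma (1 - β) * c ^ β / β := by
  have hG : ∀ t ∈ Set.Ioi (0:ℝ), ∫ x in Set.Ioc 0 c, t ^ (β - 2) * exp (-(x / t)) =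
      t ^ (β - 1) * (1 - exp (-(c / t))) := by
    intro t ht
    have ht : 0 < t := ht
    have hd : ∀ x ∈ Set.uIcc 0 c, HasDerivAt (fun x => - t ^ (β - 1) * exp (-(x / t)))
        (t ^ (β - 2) * exp (-(x / t))) x := by
      intro x _
      have := ((((hasDerivAt_id x).div_const t).neg).exp).const_mul (- t ^ (β - 1))
      refine this.congr_deriv ?_
      rw [show β - 1 = (β - 2) + 1 by ring, rpow_add_one ht.ne']
      simp
      field_simp
    rw [← intervalIntegral.integral_of_le hc.le,
      intervalIntegral.integral_eq_sub_of_hasDerivAt hd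
        (Continuous.intervalIntegrable (by fun_prop) _ _)]
    simp
    ring
  have hH : ∀ x ∈ Set.Ioc 0 c, ∫ t in Set.Ioi (0:ℝ), t ^ (β - 2) * exp (-(x / t)) =
      Gamma (1 - β) * x ^ (β - 1) := fun x hx => (integral_rpow_mul_exp_neg_div h1 hx.1).2
  have hHi : IntegrableOn (fun x : ℝ => Gamma (1 - β) * x ^ (β - 1)) (Set.Ioc 0 c) := by
    rw [← intervalIntegrable_iff_integrableOn_Ioc_of_le hc.le]
    exact (intervalIntegral.intervalIntegrable_rpow' (by linarith)).const_mul _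
  obtain ⟨hi, he⟩ := integral_swap_of_nonneg (S := Set.Ioi 0) (T := Set.Ioc 0 c)
    (F := fun t x : ℝ => t ^ (β - 2) * exp (-(x / t))) measurableSet_Ioi measurableSet_Ioc
    (by unfold Function.uncurry; fun_prop)
    (fun t ht x _ => mul_nonneg (rpow_nonneg (le_of_lt ht) _) (exp_pos _).le)
    (fun x hx => (integral_rpow_mul_exp_neg_div h1 hx.1).1)
    (hHi.congr_fun (fun x hx => (hH x hx).symm) measurableSet_Ioc)
  refine ⟨hi.congr_fun hG measurableSet_Ioi, ?_⟩
  rw [← setIntegral_congr_fun measurableSet_Ioi hG, he,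
    setIntegral_congr_fun measurableSet_Ioc hH, ← intervalIntegral.integral_of_le hc.le,
    intervalIntegral.integral_const_mul, integral_rpow (Or.inl (by linarith))]
  simp [zero_rpow h0.ne', mul_div_assoc]

/-- Computed by integrating `exp (-x ^ 2 - y ^ 2) * |y| ^ α` over the plane in polar coordinates. -/
theorem integral_sin_rpow {α : ℝ} (h0 : 0 < α) :
    ∫ θ in (0:ℝ)..π, sin θ ^ α = √π * Gamma ((α + 1) / 2) / Gamma (α / 2 + 1) := by
  have hpolar := integral_comp_polarCoord_symm
    (fun p : ℝ × ℝ => exp (-p.1 ^ 2) * (|p.2| ^ α * exp (-|p.2| ^ (2:ℝ))))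
  have hR : ∫ p : ℝ × ℝ, exp (-p.1 ^ 2) * (|p.2| ^ α * exp (-|p.2| ^ (2:ℝ))) =
      √π * Gamma ((α + 1) / 2) := by
    rw [Measure.volume_eq_prod, integral_prod_mul (fun x : ℝ => exp (-x ^ 2))
      (fun y : ℝ => |y| ^ α * exp (-|y| ^ (2:ℝ))),
      integral_comp_abs (f := fun y : ℝ => y ^ α * exp (-y ^ (2:ℝ))),
      integral_rpow_mul_exp_neg_rpow two_pos (by linarith)]
    have := integral_gaussian 1
    simp only [neg_mul, one_mul, div_one] at this
    rw [this]
    ring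
  have hL : ∫ p in polarCoord.target, p.1 • (fun p : ℝ × ℝ =>
      exp (-p.1 ^ 2) * (|p.2| ^ α * exp (-|p.2| ^ (2:ℝ)))) (polarCoord.symm p) =
      (1 / 2 * Gamma (α / 2 + 1)) * (2 * ∫ θ in (0:ℝ)..π, sin θ ^ α) := by
    have hpt : ∀ p ∈ Set.Ioi (0:ℝ) ×ˢ Set.Ioo (-π) π, p.1 • (fun p : ℝ × ℝ =>
        exp (-p.1 ^ 2) * (|p.2| ^ α * exp (-|p.2| ^ (2:ℝ)))) (polarCoord.symm p) =
        (p.1 ^ (α + 1) * exp (-p.1 ^ (2:ℝ))) * |sin p.2| ^ α := by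
      rintro ⟨r, θ⟩ ⟨hr, -⟩
      have hr : 0 < r := hr
      simp only [polarCoord_symm_apply, smul_eq_mul, rpow_two, abs_mul, abs_of_pos hr]
      rw [mul_rpow hr.le (abs_nonneg _), rpow_add_one hr.ne',
        show -r ^ 2 = -(r * cos θ) ^ 2 + -(r * |sin θ|) ^ 2 by
          rw [mul_pow, mul_pow, sq_abs, cos_sq']; ring, exp_add]
      ring
    rw [polarCoord_target, setIntegral_congr_fun (measurableSet_Ioi.prod measurableSet_Ioo) hpt,
      Measure.volume_eq_prod, setIntegral_prod_mul (fun r : ℝ => r ^ (α + 1) * exp (-r ^ (2:ℝ)))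
        (fun θ => |sin θ| ^ α), integral_rpow_mul_exp_neg_rpow two_pos (by linarith),
      ← integral_Ioc_eq_integral_Ioo, ← intervalIntegral.integral_of_le (by linarith [pi_pos])]
    have hc : Continuous fun θ : ℝ => |sin θ| ^ α :=
      continuous_sin.abs.rpow_const fun _ => Or.inr h0.le
    rw [← intervalIntegral.integral_add_adjacent_intervals (hc.intervalIntegrable (-π) 0)
      (hc.intervalIntegrable 0 π)]
    have h1 : ∫ θ in (-π)..0, |sin θ| ^ α = ∫ θ in (0:ℝ)..π, |sin θ| ^ α := by
      have := intervalIntegral.integral_comp_neg (a := 0) (b := π) fun θ : ℝ => |sin θ| ^ α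
      simpa using this.symm
    have h2 : ∫ θ in (0:ℝ)..π, |sin θ| ^ α = ∫ θ in (0:ℝ)..π, sin θ ^ α := by
      refine intervalIntegral.integral_congr fun θ hθ => ?_
      rw [Set.uIcc_of_le pi_pos.le] at hθ
      simp only [abs_of_nonneg (sin_nonneg_of_mem_Icc hθ)]
    rw [h1, h2, show (α + 1 + 1) / 2 = α / 2 + 1 by ring]
    ring
  rw [hL, hR] at hpolar
  have hΓ : Gamma (α / 2 + 1) ≠ 0 := (Gamma_pos_of_pos (by linarith)).ne'
  rw [eq_div_iff hΓ]
  linarith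

theorem integral_one_sub_cos_mul_exp_neg_mul_sq (a : ℝ) {t : ℝ} (ht : 0 < t) :
    IntegrableOn (fun s : ℝ => (1 - cos (a * s)) * exp (-t * s ^ 2)) (Set.Ioi 0) ∧
    ∫ s in Set.Ioi (0:ℝ), (1 - cos (a * s)) * exp (-t * s ^ 2) =
      √(π / t) / 2 * (1 - exp (-(a ^ 2 / 4 / t))) := by
  have hg : Integrable fun s : ℝ => exp (-t * s ^ 2) := integrable_exp_neg_mul_sq ht
  have hgc : Integrable fun s : ℝ => cos (a * s) * exp (-t * s ^ 2) :=
    hg.bdd_mul (c := 1) (by fun_prop) (.of_forall fun s => abs_cos_le_one _)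
  have hcos : ∫ s : ℝ, cos (a * s) * exp (-t * s ^ 2) =
      √(π / t) * exp (-(a ^ 2 / 4 / t)) := by
    have h := congrArg Complex.re
      (fourierIntegral_gaussian (b := (t : ℂ)) (by simpa using ht) (a : ℂ))
    have hi : Integrable fun s : ℝ =>
        Complex.exp (Complex.I * a * s) * Complex.exp (-t * s ^ 2) := by
      have : Integrable fun s : ℝ => ((exp (-t * s ^ 2) : ℝ) : ℂ) := hg.ofReal
      refine (this.bdd_mul (f := fun s : ℝ => Complex.exp (Complex.I * a * s)) (c := 1)
        (by fun_prop) (.of_forall fun s => ?_)).congr (.of_forall fun s => ?_)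
      · simp [Complex.norm_exp]
      · simp
    have hre := integral_re (𝕜 := ℂ) hi
    simp only [RCLike.re_eq_complex_re] at hre
    rw [← hre] at h
    convert h using 1
    · refine integral_congr_ae (.of_forall fun s => ?_)
      have : Complex.exp (-t * s ^ 2) = ((exp (-t * s ^ 2) : ℝ) : ℂ) := by simp
      simp only [this, Complex.re_mul_ofReal, Complex.exp_re]
      simp
    · have h1 : ((π : ℂ) / t) ^ (1 / 2 : ℂ) = ((√(π / t) : ℝ) : ℂ) := by
        rw [sqrt_eq_rpow, Complex.ofReal_cpow (by positivity)]
        simp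
      have h2 : Complex.exp (-a ^ 2 / (4 * t)) = ((exp (-(a ^ 2 / 4 / t)) : ℝ) : ℂ) := by
        push_cast
        congr 1
        field_simp
      rw [h1, h2, ← Complex.ofReal_mul, Complex.ofReal_re]
  have hsub : (fun s : ℝ => (1 - cos (a * s)) * exp (-t * s ^ 2)) =
      fun s => exp (-t * s ^ 2) - cos (a * s) * exp (-t * s ^ 2) := by
    ext s; ring
  have hfull : ∫ s : ℝ, (1 - cos (a * s)) * exp (-t * s ^ 2) =
      √(π / t) * (1 - exp (-(a ^ 2 / 4 / t))) := by
    rw [hsub, integral_sub hg hgc, integral_gaussian, hcos]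
    ring
  refine ⟨?_, ?_⟩
  · rw [hsub]
    exact (hg.sub hgc).integrableOn
  · have habs := integral_comp_abs (f := fun s : ℝ => (1 - cos (a * s)) * exp (-t * s ^ 2))
    have : ∀ s : ℝ, cos (a * |s|) = cos (a * s) := fun s => by
      rcases abs_choice s with h | h <;> simp [h]
    simp only [this, sq_abs] at habs
    linarith

/-- Obtained by writing `s ^ (-1 - α)` as a Gamma-type mixture of Gaussians in `s`. -/
theorem integral_one_sub_cos_mul_rpow {α a : ℝ} (h0 : 0 < α) (h2 : α < 2) (ha : 0 < a) :
    IntegrableOn (fun s : ℝ => (1 - cos (a * s)) * s ^ (-1 - α)) (Set.Ioi 0) ∧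
    ∫ s in Set.Ioi (0:ℝ), (1 - cos (a * s)) * s ^ (-1 - α) =
      √π * 2 ^ (-α) * Gamma (1 - α / 2) / (α * Gamma ((α + 1) / 2)) * a ^ α := by
  have hΓ : 0 < Gamma ((α + 1) / 2) := Gamma_pos_of_pos (by linarith)
  have hG : ∀ s ∈ Set.Ioi (0:ℝ), ∫ t in Set.Ioi (0:ℝ),
      (1 - cos (a * s)) * exp (-t * s ^ 2) * t ^ ((α + 1) / 2 - 1) =
      Gamma ((α + 1) / 2) * ((1 - cos (a * s)) * s ^ (-1 - α)) := by
    intro s hs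
    have hs : 0 < s := hs
    have h := integral_rpow_mul_exp_neg_mul_Ioi (a := (α + 1) / 2) (r := s ^ 2) (by linarith)
      (by positivity)
    have hpow : (1 / s ^ 2) ^ ((α + 1) / 2) = s ^ (-1 - α) := by
      rw [← rpow_two, one_div, ← rpow_neg hs.le, ← rpow_mul hs.le]
      ring_nf
    rw [hpow] at h
    calc _ = ∫ t in Set.Ioi (0:ℝ),
        (1 - cos (a * s)) * (t ^ ((α + 1) / 2 - 1) * exp (-(s ^ 2 * t))) := by
          congr 1 with t
          ring_nf
      _ = _ := by
          rw [integral_const_mul, h]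
          ring
  obtain ⟨hDi, hD⟩ := integral_rpow_mul_one_sub_exp_neg_div (β := α / 2) (c := a ^ 2 / 4)
    (by linarith) (by linarith) (by positivity)
  have hH : ∀ t ∈ Set.Ioi (0:ℝ), ∫ s in Set.Ioi (0:ℝ),
      (1 - cos (a * s)) * exp (-t * s ^ 2) * t ^ ((α + 1) / 2 - 1) =
      √π / 2 * (t ^ (α / 2 - 1) * (1 - exp (-(a ^ 2 / 4 / t)))) := by
    intro t ht
    have ht : 0 < t := ht
    rw [integral_mul_const, (integral_one_sub_cos_mul_exp_neg_mul_sq a ht).2,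
      sqrt_div pi_pos.le, show (α + 1) / 2 - 1 = α / 2 - 1 + 1 / 2 by ring, rpow_add ht,
      ← sqrt_eq_rpow]
    have : 0 < √t := sqrt_pos.2 ht
    field_simp
  obtain ⟨hi, he⟩ := integral_swap_of_nonneg (S := Set.Ioi 0) (T := Set.Ioi 0)
    (F := fun s t : ℝ => (1 - cos (a * s)) * exp (-t * s ^ 2) * t ^ ((α + 1) / 2 - 1))
    measurableSet_Ioi measurableSet_Ioi (by unfold Function.uncurry; fun_prop)
    (fun s _ t ht => mul_nonneg (mul_nonneg (sub_nonneg.2 (cos_le_one _)) (exp_pos _).le)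
      (rpow_nonneg (le_of_lt ht) _))
    (fun t ht => (integral_one_sub_cos_mul_exp_neg_mul_sq a ht).1.mul_const _)
    (IntegrableOn.congr_fun (hDi.const_mul (√π / 2)) (fun t ht => (hH t ht).symm)
      measurableSet_Ioi)
  constructor
  · have := (hi.congr_fun hG measurableSet_Ioi).const_mul (Gamma ((α + 1) / 2))⁻¹
    simp only [inv_mul_cancel_left₀ hΓ.ne'] at this
    exact this
  · have hc : (a ^ 2 / 4) ^ (α / 2) = 2 ^ (-α) * a ^ α := by
      rw [show a ^ 2 / 4 = (a / 2) ^ (2:ℝ) by rw [rpow_two]; ring, ← rpow_mul (by positivity),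
        mul_div_cancel₀ _ two_ne_zero, div_rpow ha.le two_pos.le, rpow_neg two_pos.le]
      ring
    rw [setIntegral_congr_fun measurableSet_Ioi hG, setIntegral_congr_fun measurableSet_Ioi hH,
      integral_const_mul, integral_const_mul, hD, hc] at he
    field_simp at he ⊢
    linarith

theorem one_sub_J0_eq_setIntegral (s : ℝ) :
    1 - J0 s = 1 / π * ∫ θ in Set.Ioo (0:ℝ) π, (1 - cos (sin θ * s)) := by
  rw [← integral_Ioc_eq_integral_Ioo, ← intervalIntegral.integral_of_le pi_pos.le,
    intervalIntegral.integral_sub (by simp) (Continuous.intervalIntegrable (by fun_prop) _ _)]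
  simp only [mul_comm _ s, J0, intervalIntegral.integral_const, sub_zero, smul_eq_mul, mul_one]
  field_simp

/-- For every `α ∈ (0,2)`, the integral `∫_0^∞ (1 - J₀(s)) s^{-1-α} ds`
converges absolutely and equals `2^{-α} Γ(1-α/2)/(α Γ(1+α/2))`. -/
theorem stmt6 (α : ℝ) (h0 : 0 < α) (h2 : α < 2) :
    IntegrableOn (fun s : ℝ => (1 - J0 s) * s ^ (-1 - α)) (Set.Ioi 0) ∧
    ∫ s in Set.Ioi (0:ℝ), (1 - J0 s) * s ^ (-1 - α) =
      2 ^ (-α) * Real.Gamma (1 - α / 2) / (α * Real.Gamma (1 + α / 2)) := by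
  set C := √π * 2 ^ (-α) * Gamma (1 - α / 2) / (α * Gamma ((α + 1) / 2)) with hC
  have hG : ∀ s ∈ Set.Ioi (0:ℝ), ∫ θ in Set.Ioo 0 π,
      1 / π * ((1 - cos (sin θ * s)) * s ^ (-1 - α)) = (1 - J0 s) * s ^ (-1 - α) := by
    intro s _
    rw [integral_const_mul, integral_mul_const, one_sub_J0_eq_setIntegral, mul_assoc]
  have hH : ∀ θ ∈ Set.Ioo 0 π, ∫ s in Set.Ioi (0:ℝ),
      1 / π * ((1 - cos (sin θ * s)) * s ^ (-1 - α)) = 1 / π * (C * sin θ ^ α) := by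
    intro θ hθ
    rw [integral_const_mul, (integral_one_sub_cos_mul_rpow h0 h2 (sin_pos_of_mem_Ioo hθ)).2]
  have hHi : IntegrableOn (fun θ : ℝ => 1 / π * (C * sin θ ^ α)) (Set.Ioo 0 π) := by
    have : Continuous fun θ : ℝ => 1 / π * (C * sin θ ^ α) :=
      ((continuous_sin.rpow_const fun _ => Or.inr h0.le).const_mul C).const_mul _
    exact this.integrableOn_Icc.mono_set Set.Ioo_subset_Icc_self
  obtain ⟨hi, he⟩ := integral_swap_of_nonneg (S := Set.Ioi 0) (T := Set.Ioo 0 π)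
    (F := fun s θ : ℝ => 1 / π * ((1 - cos (sin θ * s)) * s ^ (-1 - α)))
    measurableSet_Ioi measurableSet_Ioo (by unfold Function.uncurry; fun_prop)
    (fun s hs θ _ => mul_nonneg (by positivity)
      (mul_nonneg (sub_nonneg.2 (cos_le_one _)) (rpow_nonneg (le_of_lt hs) _)))
    (fun θ hθ =>
      (integral_one_sub_cos_mul_rpow h0 h2 (sin_pos_of_mem_Ioo hθ)).1.const_mul _)
    (hHi.congr_fun (fun θ hθ => (hH θ hθ).symm) measurableSet_Ioo)
  refine ⟨hi.congr_fun hG measurableSet_Ioi, ?_⟩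
  rw [← setIntegral_congr_fun measurableSet_Ioi hG, he,
    setIntegral_congr_fun measurableSet_Ioo hH, integral_const_mul, integral_const_mul,
    ← integral_Ioc_eq_integral_Ioo, ← intervalIntegral.integral_of_le pi_pos.le,
    integral_sin_rpow h0, hC, add_comm (α / 2)]
  have hΓ : Gamma ((α + 1) / 2) ≠ 0 := (Gamma_pos_of_pos (by linarith)).ne'
  have hΓ' : Gamma (1 + α / 2) ≠ 0 := (Gamma_pos_of_pos (by linarith)).ne'
  field_simp
  rw [sq_sqrt pi_pos.le]
end

section
/- Let α ∈ (0,1). For ζ ∈ ℝ² define Φ_α(ζ) = (1/(2π)²) ∫_{ℝ²} exp( −((1+α)/4) ∫_0^1 | (1+α)^{−1/α} ζ − s η |^α ds ) dη. Then Φ_α(0) = 2^{4/α} Γ(2/α) / (2πα), and lim_{ζ→0, ζ≠0} ( Φ_α(0) − Φ_α(ζ) ) / |ζ|^{α+1} = Φ_α(0) · r_α, where r_α = ( α / ( 2^{2+2/α} (1+α)^{1/α+2} ) ) · ( Γ(1/α) Γ(1/2−α/2) Γ(1+α/2) ) / ( Γ(2/α) Γ(1/2+α/2) Γ(1−α/2)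 ). -/
open MeasureTheory Real Filter

/-- A concave power is Lipschitz away from the origin. -/
lemma abs_rpow_sub_rpow_le_mul {a p q : ℝ} (h0 : 0 < a) (h1 : a ≤ 1) (hp : 0 ≤ p) (hq : 0 < q) :
    |p ^ a - q ^ a| ≤ |p - q| * q ^ (a - 1) := by
  have key : ∀ {x y : ℝ}, 0 ≤ x → 0 < y → x ≤ y → y ^ a - x ^ a ≤ (y - x) * y ^ (a - 1) := by
    intro x y hx hy hxy
    have hya : y ^ a = y * y ^ (a - 1) := by
      rw [rpow_sub_one hy.ne']; field_simp
    have hxa : x * y ^ (a - 1) ≤ x ^ a := by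
      rcases hx.eq_or_lt with rfl | hx
      · simp [zero_rpow h0.ne']
      · have : y ^ (a - 1) ≤ x ^ (a - 1) := rpow_le_rpow_of_nonpos hx hxy (by linarith)
        calc x * y ^ (a - 1) ≤ x * x ^ (a - 1) := by gcongr
          _ = x ^ a := by rw [rpow_sub_one hx.ne']; field_simp
    linarith
  rcases le_total p q with h | h
  · have := rpow_le_rpow hp h h0.le
    rw [abs_sub_comm, abs_of_nonneg (by linarith), abs_sub_comm, abs_of_nonneg (by linarith)]
    exact key hp hq h
  · have := rpow_le_rpow hq.le h h0.le
    rw [abs_of_nonneg (by linarith), abs_of_nonneg (by linarith)]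
    refine (key hq.le (hq.trans_le h) h).trans ?_
    have := rpow_le_rpow_of_nonpos hq h (by linarith : a - 1 ≤ 0)
    gcongr

/-- A concave power is Hölder continuous. -/
lemma abs_rpow_sub_rpow_le_rpow {a p q : ℝ} (h0 : 0 < a) (h1 : a ≤ 1) (hp : 0 ≤ p) (hq : 0 ≤ q) :
    |p ^ a - q ^ a| ≤ |p - q| ^ a := by
  have key : ∀ {x y : ℝ}, 0 ≤ x → x ≤ y → y ^ a - x ^ a ≤ (y - x) ^ a := by
    intro x y hx hxy
    have := rpow_add_le_add_rpow hx (sub_nonneg.2 hxy) h0.le h1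
    rw [add_sub_cancel] at this
    linarith
  rcases le_total p q with h | h
  · have := rpow_le_rpow hp h h0.le
    rw [abs_sub_comm, abs_of_nonneg (by linarith), abs_sub_comm, abs_of_nonneg (by linarith)]
    exact key hp h
  · have := rpow_le_rpow hq h h0.le
    rw [abs_of_nonneg (by linarith), abs_of_nonneg (by linarith)]
    exact key hq h

lemma integrable_one_add_sq_rpow_neg {b : ℝ} (hb : 1 / 2 < b) :
    Integrable fun s : ℝ => (1 + s ^ 2) ^ (-b) := by
  have := integrable_rpow_neg_one_add_norm_sq (E := ℝ) (μ := volume) (r := 2 * b)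
    (by simp; linarith)
  refine this.congr (ae_of_all _ fun s => ?_)
  simp only [norm_eq_abs, sq_abs]
  congr 1
  ring

lemma integral_one_add_sq_rpow_neg {b : ℝ} (hb : 1 / 2 < b) :
    ∫ s : ℝ, (1 + s ^ 2) ^ (-b) = √π * Gamma (b - 1 / 2) / Gamma b := by
  have hb0 : 0 < b := by linarith
  have hinner : ∀ s : ℝ, ∫ x in Set.Ioi (0 : ℝ), x ^ (b - 1) * rexp (-((1 + s ^ 2) * x)) =
      (1 + s ^ 2) ^ (-b) * Gamma b := by
    intro s
    have hs : 0 < 1 + s ^ 2 := by positivity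
    rw [integral_rpow_mul_exp_neg_mul_Ioi hb0 hs, one_div, inv_rpow hs.le, rpow_neg hs.le]
  have hint : Integrable (Function.uncurry fun (s x : ℝ) =>
      x ^ (b - 1) * rexp (-((1 + s ^ 2) * x))) (volume.prod (volume.restrict (Set.Ioi 0))) := by
    rw [integrable_prod_iff]
    · constructor
      · refine ae_of_all _ fun s => ?_
        refine Integrable.of_integral_ne_zero ?_
        simp only [Function.uncurry]
        rw [hinner]
        have := Gamma_pos_of_pos hb0
        positivity
      · refine ((integrable_one_add_sq_rpow_neg hb).mul_const (Gamma b)).congr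
          (ae_of_all _ fun s => ?_)
        simp only [Function.uncurry]
        rw [← hinner]
        refine setIntegral_congr_fun measurableSet_Ioi fun x hx => ?_
        have : (0 : ℝ) < x := hx
        rw [norm_of_nonneg (by positivity)]
    · exact Measurable.aestronglyMeasurable (by fun_prop)
  have hswap := integral_integral_swap hint
  simp only [hinner] at hswap
  rw [integral_mul_const] at hswap
  rw [eq_div_iff (Gamma_pos_of_pos hb0).ne', hswap]
  have : ∀ x ∈ Set.Ioi (0 : ℝ), ∫ s : ℝ, x ^ (b - 1) * rexp (-((1 + s ^ 2) * x)) =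
      √π * (x ^ (b - 1 / 2 - 1) * rexp (-(1 * x))) := by
    intro x hx
    have hx : (0 : ℝ) < x := hx
    have h : ∀ s : ℝ, x ^ (b - 1) * rexp (-((1 + s ^ 2) * x)) =
        (x ^ (b - 1) * rexp (-x)) * rexp (-x * s ^ 2) := by
      intro s
      rw [mul_assoc, ← Real.exp_add]
      ring_nf
    simp_rw [h]
    rw [integral_const_mul, integral_gaussian, sqrt_div pi_pos.le, sqrt_eq_rpow x,
      show b - 1 / 2 - 1 = (b - 1) - 1 / 2 by ring, rpow_sub hx (b - 1)]
    ring_nf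
  rw [setIntegral_congr_fun measurableSet_Ioi this, integral_const_mul,
    integral_rpow_mul_exp_neg_mul_Ioi (by linarith) one_pos]
  simp

/-- The excess of `(σ² + q²)^{a/2}` over `|σ|^a`. -/
noncomputable def rpowExcess (a q σ : ℝ) : ℝ := (σ ^ 2 + q ^ 2) ^ (a / 2) - |σ| ^ a

lemma abs_rpow_eq_sq_rpow (a s : ℝ) : |s| ^ a = (s ^ 2) ^ (a / 2) := by
  rw [← sq_abs, ← rpow_natCast, ← rpow_mul (abs_nonneg s)]
  congr 1
  push_cast
  ring

lemma rpowExcess_nonneg {a : ℝ} (h0 : 0 < a) (q σ : ℝ) : 0 ≤ rpowExcess a q σ := by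
  unfold rpowExcess
  rw [abs_rpow_eq_sq_rpow, sub_nonneg]
  exact rpow_le_rpow (sq_nonneg _) (by nlinarith [sq_nonneg q]) (by linarith)

lemma continuous_rpowExcess {a : ℝ} (h0 : 0 < a) (q : ℝ) : Continuous (rpowExcess a q) := by
  unfold rpowExcess
  exact (Continuous.rpow_const (by fun_prop) fun _ => Or.inr (by linarith)).sub
    (Continuous.rpow_const (by fun_prop) fun _ => Or.inr h0.le)

lemma rpowExcess_one_le {a : ℝ} (h0 : 0 < a) (h1 : a < 1) (σ : ℝ) :
    rpowExcess a 1 σ ≤ (1 + σ ^ 2) ^ (-(1 - a / 2)) := by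
  have := abs_rpow_sub_rpow_le_mul (a := a / 2) (p := σ ^ 2) (q := 1 + σ ^ 2) (by linarith)
    (by linarith) (by positivity) (by positivity)
  rw [abs_sub_comm, abs_sub_comm (σ ^ 2)] at this
  simp only [add_sub_cancel_right, abs_one, one_mul] at this
  unfold rpowExcess
  rw [abs_rpow_eq_sq_rpow, show -(1 - a / 2) = a / 2 - 1 by ring, one_pow, add_comm (σ ^ 2)]
  exact (le_abs_self _).trans this

lemma integrable_rpowExcess_one {a : ℝ} (h0 : 0 < a) (h1 : a < 1) :
    Integrable (rpowExcess a 1) := by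
  refine (integrable_one_add_sq_rpow_neg (b := 1 - a / 2) (by linarith)).mono'
    (continuous_rpowExcess h0 1).aestronglyMeasurable (ae_of_all _ fun σ => ?_)
  rw [norm_of_nonneg (rpowExcess_nonneg h0 _ _)]
  exact rpowExcess_one_le h0 h1 σ

lemma integral_rpowExcess_one {a : ℝ} (h0 : 0 < a) (h1 : a < 1) :
    ∫ σ, rpowExcess a 1 σ =
      a / (1 + a) * (√π * Gamma (1 / 2 - a / 2) / Gamma (1 - a / 2)) := by
  have hb : (1 : ℝ) / 2 < 1 - a / 2 := by linarith
  have heven : ∀ σ, rpowExcess a 1 σ = rpowExcess a 1 |σ| := by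
    intro σ; simp [rpowExcess]
  have hderiv : ∀ x ∈ Set.Ioi (0 : ℝ), HasDerivAt (fun σ => σ * rpowExcess a 1 σ)
      ((1 + a) * rpowExcess a 1 x - a * (1 + x ^ 2) ^ (-(1 - a / 2))) x := by
    intro x hx
    have hx : 0 < x := hx
    have hpos : 0 < x ^ 2 + 1 := by positivity
    have h2 : HasDerivAt (fun σ : ℝ => (σ ^ 2 + 1) ^ (a / 2))
        (2 * x * (a / 2) * (x ^ 2 + 1) ^ (a / 2 - 1)) x := by
      have := (((hasDerivAt_id x).pow 2).add_const 1).rpow_const (p := a / 2) (Or.inl hpos.ne')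
      simpa using this
    have h3 : HasDerivAt (fun σ : ℝ => σ ^ a) (a * x ^ (a - 1)) x :=
      hasDerivAt_rpow_const (Or.inl hx.ne')
    have h4 : HasDerivAt (fun σ : ℝ => σ * ((σ ^ 2 + 1) ^ (a / 2) - σ ^ a)) _ x :=
      (hasDerivAt_id x).mul (h2.sub h3)
    have h5 : (fun σ => σ * rpowExcess a 1 σ) =ᶠ[nhds x]
        fun σ : ℝ => σ * ((σ ^ 2 + 1) ^ (a / 2) - σ ^ a) := by
      filter_upwards [lt_mem_nhds hx] with σ hσ
      simp [rpowExcess, abs_of_pos hσ]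
    refine (h4.congr_of_eventuallyEq h5).congr_deriv ?_
    have e1 : (x ^ 2 + 1) ^ (a / 2) = (x ^ 2 + 1) * (x ^ 2 + 1) ^ (a / 2 - 1) := by
      rw [rpow_sub_one hpos.ne']; field_simp
    have e2 : x ^ a = x * x ^ (a - 1) := by
      rw [rpow_sub_one hx.ne']; field_simp
    simp only [rpowExcess, abs_of_pos hx, id, one_pow]
    rw [show -(1 - a / 2) = a / 2 - 1 by ring, add_comm 1 (x ^ 2), e1, e2]
    ring
  have hI1 := (integrable_rpowExcess_one h0 h1).integrableOn (s := Set.Ioi 0)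
  have hI2 := (integrable_one_add_sq_rpow_neg hb).integrableOn (s := Set.Ioi 0)
  have htend : Tendsto (fun σ => σ * rpowExcess a 1 σ) atTop (nhds 0) := by
    have hlim : Tendsto (fun σ : ℝ => σ ^ (-(1 - a))) atTop (nhds 0) :=
      tendsto_rpow_neg_atTop (by linarith)
    refine squeeze_zero' ?_ ?_ hlim
    · filter_upwards [eventually_gt_atTop 0] with σ hσ
      exact mul_nonneg hσ.le (rpowExcess_nonneg h0 _ _)
    · filter_upwards [eventually_gt_atTop 0] with σ hσ
      have h : (1 + σ ^ 2) ^ (-(1 - a / 2)) ≤ (σ ^ 2) ^ (-(1 - a / 2)) :=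
        rpow_le_rpow_of_nonpos (by positivity) (by linarith) (by linarith)
      calc σ * rpowExcess a 1 σ ≤ σ * (σ ^ 2) ^ (-(1 - a / 2)) := by
            gcongr
            exact (rpowExcess_one_le h0 h1 σ).trans h
        _ = σ ^ (-(1 - a)) := by
            rw [← rpow_natCast, ← rpow_mul hσ.le]
            nth_rewrite 1 [← rpow_one σ]
            rw [← rpow_add hσ]
            congr 1
            push_cast
            ring
  have hFTC := integral_Ioi_of_hasDerivAt_of_tendsto
    (continuous_id.mul (continuous_rpowExcess h0 1)).continuousWithinAt hderiv
    ((hI1.const_mul (1 + a)).sub (hI2.const_mul a)) htend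
  rw [integral_sub (hI1.const_mul (1 + a)) (hI2.const_mul a), integral_const_mul,
    integral_const_mul] at hFTC
  simp only [Pi.mul_apply, id, zero_mul, sub_zero, sub_eq_zero] at hFTC
  have hJ : 2 * ∫ σ in Set.Ioi (0 : ℝ), (1 + σ ^ 2) ^ (-(1 - a / 2)) =
      √π * Gamma (1 / 2 - a / 2) / Gamma (1 - a / 2) := by
    rw [← integral_comp_abs (f := fun σ : ℝ => (1 + σ ^ 2) ^ (-(1 - a / 2)))]
    simp only [sq_abs]
    rw [integral_one_add_sq_rpow_neg hb]
    ring_nf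
  rw [← hJ]
  rw [integral_congr_ae (ae_of_all _ heven), integral_comp_abs (f := rpowExcess a 1)]
  rw [div_mul_eq_mul_div, eq_div_iff (by linarith : 1 + a ≠ 0)]
  linear_combination 2 * hFTC

lemma rpowExcess_eq_scale {a q : ℝ} (hq : 0 < q) (σ : ℝ) :
    rpowExcess a q σ = q ^ a * rpowExcess a 1 (σ / q) := by
  unfold rpowExcess
  have : σ ^ 2 + q ^ 2 = q ^ 2 * ((σ / q) ^ 2 + 1 ^ 2) := by field_simp
  rw [this, mul_rpow (by positivity) (by positivity), ← abs_rpow_eq_sq_rpow, abs_of_pos hq,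
    abs_div, abs_of_pos hq, div_rpow (abs_nonneg _) hq.le]
  have : 0 < q ^ a := by positivity
  field_simp

lemma rpowExcess_zero (a σ : ℝ) : rpowExcess a 0 σ = 0 := by
  simp [rpowExcess, abs_rpow_eq_sq_rpow]

lemma integrable_rpowExcess {a q : ℝ} (h0 : 0 < a) (h1 : a < 1) (hq : 0 ≤ q) :
    Integrable (rpowExcess a q) := by
  rcases hq.eq_or_lt with rfl | hq
  · exact (integrable_zero _ _ _).congr (ae_of_all _ fun σ => (rpowExcess_zero a σ).symm)
  · exact (((integrable_rpowExcess_one h0 h1).comp_div hq.ne').const_mul (q ^ a)).congr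
      (ae_of_all _ fun σ => (rpowExcess_eq_scale hq σ).symm)

lemma integral_rpowExcess {a q : ℝ} (h0 : 0 < a) (hq : 0 ≤ q) :
    ∫ σ, rpowExcess a q σ = q ^ (1 + a) * ∫ σ, rpowExcess a 1 σ := by
  rcases hq.eq_or_lt with rfl | hq
  · simp [rpowExcess_zero, zero_rpow (by linarith : 1 + a ≠ 0)]
  · simp_rw [rpowExcess_eq_scale (a := a) hq]
    rw [integral_const_mul, Measure.integral_comp_div, abs_of_pos hq, rpow_add hq, rpow_one,
      smul_eq_mul]
    ring

lemma continuous_abs_rpow {a : ℝ} (h0 : 0 < a) : Continuous fun σ : ℝ => |σ| ^ a :=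
  continuous_abs.rpow_const fun _ => Or.inr h0.le

lemma integral_abs_shift_sub {a : ℝ} (h0 : 0 < a) (p T : ℝ) :
    ∫ σ in -T..T, (|σ - p| ^ a - |σ| ^ a) =
      ∫ x in (0 : ℝ)..p, (|x + T| ^ a - |x + (T - p)| ^ a) := by
  have hc := continuous_abs_rpow h0
  have hi : ∀ u v, IntervalIntegrable (fun σ : ℝ => |σ| ^ a) volume u v :=
    fun u v => hc.intervalIntegrable u v
  have hs : ∀ c u v, IntervalIntegrable (fun σ : ℝ => |σ + c| ^ a) volume u v :=
    fun c u v => (hc.comp (continuous_id.add continuous_const)).intervalIntegrable u v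
  have hs' : ∀ c u v, IntervalIntegrable (fun σ : ℝ => |σ - c| ^ a) volume u v :=
    fun c u v => (hc.comp (continuous_id.sub continuous_const)).intervalIntegrable u v
  rw [intervalIntegral.integral_sub (hs' _ _ _) (hi _ _),
    intervalIntegral.integral_sub (hs _ _ _) (hs _ _ _),
    intervalIntegral.integral_comp_sub_right (fun σ : ℝ => |σ| ^ a),
    intervalIntegral.integral_comp_add_right (fun σ : ℝ => |σ| ^ a),
    intervalIntegral.integral_comp_add_right (fun σ : ℝ => |σ| ^ a)]
  have e1 : ∫ σ in -T - p..-T, |σ| ^ a = ∫ σ in T..T + p, |σ| ^ a := by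
    have := intervalIntegral.integral_comp_neg (a := T) (b := T + p) (fun σ : ℝ => |σ| ^ a)
    simp only [abs_neg] at this
    rw [this]
    congr 1
    ring
  have e2 := intervalIntegral.integral_add_adjacent_intervals (hi (-T - p) (-T)) (hi (-T) (T - p))
  have e3 := intervalIntegral.integral_add_adjacent_intervals (hi (-T) (T - p)) (hi (T - p) T)
  rw [e1] at e2
  simp only [zero_add, add_sub_cancel, add_comm p T]
  linarith

lemma abs_integral_abs_shift_sub_le {a p : ℝ} (h0 : 0 < a) (h1 : a < 1) (hp : |p| ≤ 1) (T : ℝ) :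
    |∫ σ in -T..T, (|σ - p| ^ a - |σ| ^ a)| ≤ 1 := by
  rw [integral_abs_shift_sub h0]
  have := intervalIntegral.norm_integral_le_of_norm_le_const (a := 0) (b := p) (C := 1)
    (f := fun x => |x + T| ^ a - |x + (T - p)| ^ a) (fun x _ => by
      rw [norm_eq_abs]
      refine (abs_rpow_sub_rpow_le_rpow h0 h1.le (abs_nonneg _) (abs_nonneg _)).trans ?_
      refine rpow_le_one (abs_nonneg _) ((abs_abs_sub_abs_le _ _).trans ?_) h0.le
      rwa [show x + T - (x + (T - p)) = p by ring])
  rw [norm_eq_abs] at this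
  refine this.trans ?_
  rwa [sub_zero, one_mul]

lemma tendsto_integral_abs_shift_sub {a p : ℝ} (h0 : 0 < a) (h1 : a < 1) (hp : |p| ≤ 1) :
    Tendsto (fun T => ∫ σ in -T..T, (|σ - p| ^ a - |σ| ^ a)) atTop (nhds 0) := by
  have hlim : Tendsto (fun T : ℝ => (T - 1) ^ (-(1 - a))) atTop (nhds 0) :=
    (tendsto_rpow_neg_atTop (by linarith)).comp (tendsto_atTop_add_const_right _ (-1) tendsto_id)
  refine squeeze_zero_norm' ?_ hlim
  filter_upwards [eventually_gt_atTop 1] with T hT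
  rw [integral_abs_shift_sub h0]
  have := intervalIntegral.norm_integral_le_of_norm_le_const (a := 0) (b := p)
    (C := (T - 1) ^ (-(1 - a)))
    (f := fun x => |x + T| ^ a - |x + (T - p)| ^ a) (fun x hx => by
      have hx1 : |x| ≤ 1 := by
        have hp' := abs_le.1 hp
        rcases Set.mem_uIoc.1 hx with h | h <;> exact abs_le.2 ⟨by linarith, by linarith⟩
      have hx2 := abs_le.1 hx1
      have hpos : 0 < x + T := by linarith
      rw [norm_eq_abs, abs_sub_comm]
      refine (abs_rpow_sub_rpow_le_mul h0 h1.le (abs_nonneg _)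
        (abs_pos.2 hpos.ne')).trans ?_
      rw [abs_of_pos hpos]
      have e1 : |(|x + (T - p)| - (x + T))| ≤ 1 := by
        nth_rewrite 1 [← abs_of_pos hpos]
        refine (abs_abs_sub_abs_le _ _).trans ?_
        rwa [show x + (T - p) - (x + T) = -p by ring, abs_neg]
      have e2 : (x + T) ^ (a - 1) ≤ (T - 1) ^ (a - 1) :=
        rpow_le_rpow_of_nonpos (by linarith) (by linarith) (by linarith)
      have e3 : 0 ≤ (x + T) ^ (a - 1) := by positivity
      rw [show -(1 - a) = a - 1 by ring]
      nlinarith [abs_nonneg (|x + (T - p)| - (x + T))])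
  refine this.trans ?_
  rw [sub_zero]
  have : 0 ≤ (T - 1) ^ (-(1 - a)) := rpow_nonneg (by linarith) _
  nlinarith [abs_nonneg p]

/-- The symmetric truncated integral of `‖1 - σ u‖^a - |σ|^a` for a unit vector `u = p + i q`. -/
noncomputable def lineExcess (a p q T : ℝ) : ℝ :=
  ∫ σ in -T..T, (((σ - p) ^ 2 + q ^ 2) ^ (a / 2) - |σ| ^ a)

lemma lineExcess_eq {a : ℝ} (h0 : 0 < a) (p q T : ℝ) :
    lineExcess a p q T = (∫ σ in -T..T, rpowExcess a q (σ - p)) +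
      ∫ σ in -T..T, (|σ - p| ^ a - |σ| ^ a) := by
  have hc := continuous_abs_rpow h0
  rw [lineExcess, ← intervalIntegral.integral_add]
  · simp [rpowExcess]
  · exact ((continuous_rpowExcess h0 q).comp
      (continuous_id.sub continuous_const)).intervalIntegrable _ _
  · exact ((hc.comp (continuous_id.sub continuous_const)).sub hc).intervalIntegrable _ _

lemma tendsto_lineExcess {a p q : ℝ} (h0 : 0 < a) (h1 : a < 1) (hp : |p| ≤ 1) (hq : 0 ≤ q) :
    Tendsto (lineExcess a p q) atTop (nhds (q ^ (1 + a) * ∫ σ, rpowExcess a 1 σ)) := by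
  have h := (intervalIntegral_tendsto_integral ((integrable_rpowExcess h0 h1 hq).comp_sub_right p)
    tendsto_neg_atTop_atBot tendsto_id).add (tendsto_integral_abs_shift_sub h0 h1 hp)
  rw [add_zero, integral_sub_right_eq_self (rpowExcess a q), integral_rpowExcess h0 hq] at h
  exact h.congr fun T => (lineExcess_eq h0 p q T).symm

lemma abs_lineExcess_le {a p q T : ℝ} (h0 : 0 < a) (h1 : a < 1) (hp : |p| ≤ 1) (hq : 0 ≤ q)
    (hq1 : q ≤ 1) (hT : 0 ≤ T) :
    |lineExcess a p q T| ≤ (∫ σ, rpowExcess a 1 σ) + 1 := by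
  rw [lineExcess_eq h0]
  refine (abs_add_le _ _).trans (add_le_add ?_ (abs_integral_abs_shift_sub_le h0 h1 hp T))
  have hnn : ∀ σ, 0 ≤ rpowExcess a q (σ - p) := fun σ => rpowExcess_nonneg h0 _ _
  have hc : 0 ≤ ∫ σ, rpowExcess a 1 σ := integral_nonneg fun σ => rpowExcess_nonneg h0 _ _
  rw [intervalIntegral.integral_of_le (by linarith), abs_of_nonneg (integral_nonneg hnn)]
  refine (setIntegral_le_integral ((integrable_rpowExcess h0 h1 hq).comp_sub_right p)
    (ae_of_all _ hnn)).trans ?_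
  rw [integral_sub_right_eq_self (rpowExcess a q), integral_rpowExcess h0 hq]
  exact mul_le_of_le_one_left hc (rpow_le_one hq hq1 (by linarith))

lemma integral_polar_separated (f g : ℝ → ℝ) {F : ℂ → ℝ}
    (hF : ∀ r θ : ℝ, 0 < r → F (r * (Real.cos θ + Real.sin θ * Complex.I)) = f r * g θ) :
    ∫ z, F z = (∫ r in Set.Ioi (0 : ℝ), r * f r) * ∫ θ in Set.Ioo (-π) π, g θ := by
  rw [← Complex.integral_comp_polarCoord_symm, polarCoord_target,
    ← setIntegral_prod_mul (fun r => r * f r) g, ← Measure.volume_eq_prod]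
  refine setIntegral_congr_fun (measurableSet_Ioi.prod measurableSet_Ioo) fun x hx => ?_
  have hx0 : 0 < x.1 := hx.1
  simp only [Complex.polarCoord_symm_apply, smul_eq_mul]
  rw [hF _ _ hx0, mul_assoc]

lemma norm_polar {r : ℝ} (hr : 0 < r) (θ : ℝ) :
    ‖(r * (Real.cos θ + Real.sin θ * Complex.I) : ℂ)‖ = r := by
  rw [norm_mul, Complex.ofReal_cos, Complex.ofReal_sin, Complex.norm_cos_add_sin_mul_I, mul_one,
    Complex.norm_real, norm_of_nonneg hr.le]

lemma im_polar (r θ : ℝ) :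
    (r * (Real.cos θ + Real.sin θ * Complex.I) : ℂ).im = r * Real.sin θ := by
  simp [-Complex.ofReal_cos, -Complex.ofReal_sin]

lemma integral_norm_rpow_mul_exp_neg {k p b : ℝ} (hk : -2 < k) (hp : 0 < p) (hb : 0 < b) :
    ∫ z : ℂ, ‖z‖ ^ k * rexp (-b * ‖z‖ ^ p) =
      2 * π * (b ^ (-(k + 2) / p) * (1 / p) * Gamma ((k + 2) / p)) := by
  rw [integral_polar_separated (fun r => r ^ k * rexp (-b * r ^ p)) (fun _ => 1)
    (fun r θ hr => by rw [norm_polar hr, mul_one])]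
  have h : ∀ r ∈ Set.Ioi (0 : ℝ), r * (r ^ k * rexp (-b * r ^ p)) =
      r ^ (k + 1) * rexp (-b * r ^ p) := by
    intro r hr
    rw [rpow_add_one (ne_of_gt hr)]
    ring
  rw [setIntegral_congr_fun measurableSet_Ioi h,
    integral_rpow_mul_exp_neg_mul_rpow hp (by linarith) hb]
  simp only [integral_const, MeasurableSet.univ, measureReal_restrict_apply, Set.univ_inter,
    volume_real_Ioo, smul_eq_mul, mul_one]
  rw [show k + 1 + 1 = k + 2 by ring, max_eq_left (by linarith [pi_pos])]
  ring

lemma integrable_norm_rpow_mul_exp_neg {k p b : ℝ} (hk : -2 < k) (hp : 0 < p) (hb : 0 < b) :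
    Integrable fun z : ℂ => ‖z‖ ^ k * rexp (-b * ‖z‖ ^ p) := by
  refine Integrable.of_integral_ne_zero ?_
  rw [integral_norm_rpow_mul_exp_neg hk hp hb]
  have := Gamma_pos_of_pos (div_pos (by linarith : 0 < k + 2) hp)
  positivity

lemma integral_abs_rpow_mul_gaussian {p : ℝ} (hp : -1 < p) :
    ∫ x : ℝ, |x| ^ p * rexp (-x ^ 2) = Gamma ((p + 1) / 2) := by
  have h := integral_comp_abs (f := fun x : ℝ => x ^ p * rexp (-1 * x ^ (2 : ℝ)))
  rw [integral_rpow_mul_exp_neg_mul_rpow two_pos hp one_pos] at h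
  simp only [rpow_two, sq_abs, neg_one_mul] at h
  rw [h, one_rpow]
  ring

lemma integral_abs_sin_rpow {p : ℝ} (hp : -1 < p) :
    ∫ θ in Set.Ioo (-π) π, |Real.sin θ| ^ p =
      2 * √π * Gamma ((p + 1) / 2) / Gamma (p / 2 + 1) := by
  have hpol : ∫ z : ℂ, |z.im| ^ p * rexp (-‖z‖ ^ 2) =
      (∫ r in Set.Ioi (0 : ℝ), r * (r ^ p * rexp (-r ^ 2))) *
        ∫ θ in Set.Ioo (-π) π, |Real.sin θ| ^ p := by
    refine integral_polar_separated _ _ fun r θ hr => ?_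
    rw [norm_polar hr, im_polar, abs_mul, abs_of_pos hr, mul_rpow hr.le (abs_nonneg _)]
    ring
  have hcart : ∫ z : ℂ, |z.im| ^ p * rexp (-‖z‖ ^ 2) = √π * Gamma ((p + 1) / 2) := by
    have h := Complex.volume_preserving_equiv_real_prod.integral_comp'
      (fun x : ℝ × ℝ => rexp (-x.1 ^ 2) * (|x.2| ^ p * rexp (-x.2 ^ 2)))
    rw [Measure.volume_eq_prod, integral_prod_mul (fun x : ℝ => rexp (-x ^ 2))
      (fun x : ℝ => |x| ^ p * rexp (-x ^ 2)), integral_abs_rpow_mul_gaussian hp] at h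
    have hg := integral_gaussian 1
    simp only [neg_one_mul, div_one] at hg
    rw [hg] at h
    rw [← h]
    refine integral_congr_ae (ae_of_all _ fun z => ?_)
    simp only [Complex.measurableEquivRealProd_apply]
    rw [Complex.sq_norm, Complex.normSq_apply,
      show -(z.re * z.re + z.im * z.im) = -z.re ^ 2 + -z.im ^ 2 by ring, Real.exp_add]
    ring
  have hrad : ∫ r in Set.Ioi (0 : ℝ), r * (r ^ p * rexp (-r ^ 2)) = Gamma (p / 2 + 1) / 2 := by
    have h : ∀ r ∈ Set.Ioi (0 : ℝ), r * (r ^ p * rexp (-r ^ 2)) =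
        r ^ (p + 1) * rexp (-1 * r ^ (2 : ℝ)) := by
      intro r hr
      rw [rpow_add_one (ne_of_gt hr), rpow_two]
      ring_nf
    rw [setIntegral_congr_fun measurableSet_Ioi h,
      integral_rpow_mul_exp_neg_mul_rpow two_pos (by linarith) one_pos, one_rpow]
    ring_nf
  rw [hcart, hrad] at hpol
  have := Gamma_pos_of_pos (by linarith : 0 < p / 2 + 1)
  rw [eq_div_iff this.ne']
  linarith

/-- The integral of `‖ρ - z‖^a` along the segment from `0` to `η`, normalized by its length. -/
noncomputable def segmentMean (a ρ : ℝ) (η : ℂ) : ℝ := ∫ s in (0 : ℝ)..1, ‖(ρ : ℂ) - s • η‖ ^ a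

lemma continuous_norm_sub_smul_rpow {a : ℝ} (h0 : 0 < a) (ρ : ℝ) :
    Continuous fun x : ℂ × ℝ => ‖(ρ : ℂ) - x.2 • x.1‖ ^ a :=
  Continuous.rpow_const (by fun_prop) fun _ => Or.inr h0.le

lemma intervalIntegrable_norm_sub_smul_rpow {a : ℝ} (h0 : 0 < a) (ρ : ℝ) (η : ℂ) (u v : ℝ) :
    IntervalIntegrable (fun s : ℝ => ‖(ρ : ℂ) - s • η‖ ^ a) volume u v :=
  ((continuous_norm_sub_smul_rpow h0 ρ).comp
    (continuous_const.prodMk continuous_id : Continuous fun s : ℝ => (η, s))).intervalIntegrable _ _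

lemma continuous_segmentMean {a : ℝ} (h0 : 0 < a) (ρ : ℝ) : Continuous (segmentMean a ρ) :=
  intervalIntegral.continuous_parametric_intervalIntegral_of_continuous'
    (f := fun (η : ℂ) (s : ℝ) => ‖(ρ : ℂ) - s • η‖ ^ a) (continuous_norm_sub_smul_rpow h0 ρ) 0 1

lemma integral_abs_rpow_mul {a : ℝ} (h0 : 0 < a) (r : ℝ) :
    ∫ s in (0 : ℝ)..1, |s| ^ a * r = r / (1 + a) := by
  rw [intervalIntegral.integral_mul_const]
  have : ∫ s in (0 : ℝ)..1, |s| ^ a = ∫ s in (0 : ℝ)..1, s ^ a := by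
    refine intervalIntegral.integral_congr fun s hs => ?_
    rw [Set.uIcc_of_le zero_le_one] at hs
    simp only [abs_of_nonneg hs.1]
  rw [this, integral_rpow (Or.inl (by linarith)), one_rpow, zero_rpow (by linarith)]
  have : (1 : ℝ) + a ≠ 0 := by linarith
  rw [add_comm a]
  field_simp
  ring

lemma intervalIntegrable_abs_rpow_mul {a : ℝ} (h0 : 0 < a) (r u v : ℝ) :
    IntervalIntegrable (fun s : ℝ => |s| ^ a * r) volume u v :=
  ((continuous_abs_rpow h0).mul continuous_const).intervalIntegrable _ _

lemma segmentMean_sub_eq {a : ℝ} (h0 : 0 < a) (ρ : ℝ) (η : ℂ) :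
    segmentMean a ρ η - ‖η‖ ^ a / (1 + a) =
      ∫ s in (0 : ℝ)..1, (‖(ρ : ℂ) - s • η‖ ^ a - |s| ^ a * ‖η‖ ^ a) := by
  rw [intervalIntegral.integral_sub (intervalIntegrable_norm_sub_smul_rpow h0 _ _ _ _)
    (intervalIntegrable_abs_rpow_mul h0 _ _ _), integral_abs_rpow_mul h0, segmentMean]

lemma abs_norm_sub_smul_sub_le {ρ : ℝ} (hρ : 0 ≤ ρ) (s : ℝ) (η : ℂ) :
    |‖(ρ : ℂ) - s • η‖ - ‖s • η‖| ≤ ρ := by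
  have h := abs_norm_sub_norm_le ((ρ : ℂ) - s • η) (-(s • η))
  rw [norm_neg] at h
  refine h.trans ?_
  simp [abs_of_nonneg hρ]

lemma abs_segmentMean_sub_le_rpow {a ρ : ℝ} (h0 : 0 < a) (h1 : a < 1) (hρ : 0 ≤ ρ) (η : ℂ) :
    |segmentMean a ρ η - ‖η‖ ^ a / (1 + a)| ≤ ρ ^ a := by
  rw [segmentMean_sub_eq h0]
  have := intervalIntegral.norm_integral_le_of_norm_le_const (a := 0) (b := 1) (C := ρ ^ a)
    (f := fun s : ℝ => ‖(ρ : ℂ) - s • η‖ ^ a - |s| ^ a * ‖η‖ ^ a) (fun s _ => by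
      rw [norm_eq_abs, ← mul_rpow (abs_nonneg _) (norm_nonneg _), ← norm_eq_abs s, ← norm_smul]
      refine (abs_rpow_sub_rpow_le_rpow h0 h1.le (norm_nonneg _) (norm_nonneg _)).trans ?_
      exact rpow_le_rpow (abs_nonneg _) (abs_norm_sub_smul_sub_le hρ s η) h0.le)
  simpa using this

lemma abs_segmentMean_sub_le_mul {a ρ : ℝ} (h0 : 0 < a) (h1 : a < 1) (hρ : 0 ≤ ρ) {η : ℂ}
    (hη : η ≠ 0) :
    |segmentMean a ρ η - ‖η‖ ^ a / (1 + a)| ≤ ρ * ‖η‖ ^ (a - 1) / a := by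
  have hr : 0 < ‖η‖ := norm_pos_iff.2 hη
  rw [segmentMean_sub_eq h0]
  have hint : IntervalIntegrable (fun s : ℝ => ρ * ‖η‖ ^ (a - 1) * s ^ (a - 1)) volume 0 1 :=
    (intervalIntegral.intervalIntegrable_rpow' (by linarith)).const_mul _
  have := intervalIntegral.norm_integral_le_of_norm_le (μ := volume) zero_le_one
    (f := fun s : ℝ => ‖(ρ : ℂ) - s • η‖ ^ a - |s| ^ a * ‖η‖ ^ a) (ae_of_all _ fun s hs => by
      have hs0 : 0 < s := hs.1
      rw [norm_eq_abs, ← mul_rpow (abs_nonneg _) (norm_nonneg _), ← norm_eq_abs s, ← norm_smul]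
      refine (abs_rpow_sub_rpow_le_mul h0 h1.le (norm_nonneg _)
        (norm_pos_iff.2 (smul_ne_zero hs0.ne' hη))).trans ?_
      rw [norm_smul, norm_of_nonneg hs0.le, mul_rpow hs0.le hr.le]
      have h := abs_norm_sub_smul_sub_le hρ s η
      rw [norm_smul, norm_of_nonneg hs0.le] at h
      calc _ ≤ ρ * (s ^ (a - 1) * ‖η‖ ^ (a - 1)) := by gcongr
        _ = ρ * ‖η‖ ^ (a - 1) * s ^ (a - 1) := by ring) hint
  rw [norm_eq_abs, intervalIntegral.integral_const_mul, integral_rpow (Or.inl (by linarith)),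
    sub_add_cancel, one_rpow, zero_rpow h0.ne'] at this
  refine this.trans (le_of_eq ?_)
  ring

lemma norm_sub_smul_sub_eq {a ρ : ℝ} (hρ : 0 < ρ) {η : ℂ} (hη : η ≠ 0) (s : ℝ) :
    ‖(ρ : ℂ) - s • η‖ ^ a - |s| ^ a * ‖η‖ ^ a =
      ρ ^ a * (((s * (‖η‖ / ρ) - η.re / ‖η‖) ^ 2 + (|η.im| / ‖η‖) ^ 2) ^ (a / 2) -
        |s * (‖η‖ / ρ)| ^ a) := by
  have hr : 0 < ‖η‖ := norm_pos_iff.2 hη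
  have hsq : ‖η‖ ^ 2 = η.re ^ 2 + η.im ^ 2 := by
    rw [Complex.sq_norm, Complex.normSq_apply]; ring
  have hnorm : ‖(ρ : ℂ) - s • η‖ ^ 2 =
      ρ ^ 2 * ((s * (‖η‖ / ρ) - η.re / ‖η‖) ^ 2 + (|η.im| / ‖η‖) ^ 2) := by
    rw [Complex.sq_norm, Complex.normSq_apply]
    simp only [Complex.sub_re, Complex.ofReal_re, Complex.smul_re, smul_eq_mul, Complex.sub_im,
      Complex.ofReal_im, Complex.smul_im]
    rw [div_pow |η.im|, sq_abs]
    have hR : ρ ^ 2 * ((s * (‖η‖ / ρ) - η.re / ‖η‖) ^ 2 + η.im ^ 2 / ‖η‖ ^ 2) =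
        s ^ 2 * ‖η‖ ^ 2 - 2 * s * ρ * η.re + ρ ^ 2 * ((η.re ^ 2 + η.im ^ 2) / ‖η‖ ^ 2) := by
      field_simp
      ring
    rw [hR, ← hsq, div_self (by positivity), hsq]
    ring
  rw [mul_sub, ← abs_norm ((ρ : ℂ) - s • η), abs_rpow_eq_sq_rpow, hnorm,
    mul_rpow (by positivity) (by positivity), ← abs_rpow_eq_sq_rpow, abs_of_pos hρ, abs_mul,
    abs_of_pos (div_pos hr hρ), ← mul_rpow (abs_nonneg _) hr.le,
    ← mul_rpow hρ.le (by positivity)]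
  congr 2
  field_simp

lemma segmentMean_add_neg {a ρ : ℝ} (h0 : 0 < a) (hρ : 0 < ρ) {η : ℂ} (hη : η ≠ 0) :
    (segmentMean a ρ η - ‖η‖ ^ a / (1 + a)) + (segmentMean a ρ (-η) - ‖η‖ ^ a / (1 + a)) =
      ρ ^ (1 + a) * (lineExcess a (η.re / ‖η‖) (|η.im| / ‖η‖) (‖η‖ / ρ) / ‖η‖) := by
  have hr : 0 < ‖η‖ := norm_pos_iff.2 hη
  have hint : ∀ u v, IntervalIntegrable
      (fun s : ℝ => ‖(ρ : ℂ) - s • η‖ ^ a - |s| ^ a * ‖η‖ ^ a) volume u v := fun u v =>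
    (intervalIntegrable_norm_sub_smul_rpow h0 _ _ _ _).sub (intervalIntegrable_abs_rpow_mul h0 _ _ _)
  have hneg : segmentMean a ρ (-η) - ‖η‖ ^ a / (1 + a) =
      ∫ s in (-1 : ℝ)..0, (‖(ρ : ℂ) - s • η‖ ^ a - |s| ^ a * ‖η‖ ^ a) := by
    have h := segmentMean_sub_eq h0 ρ (-η)
    rw [norm_neg] at h
    rw [h]
    have h' := intervalIntegral.integral_comp_neg (a := 0) (b := 1)
      (fun s : ℝ => ‖(ρ : ℂ) - s • η‖ ^ a - |s| ^ a * ‖η‖ ^ a)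
    rw [neg_zero] at h'
    rw [← h']
    simp
  rw [segmentMean_sub_eq h0, hneg, add_comm,
    intervalIntegral.integral_add_adjacent_intervals (hint _ _) (hint _ _)]
  simp_rw [norm_sub_smul_sub_eq hρ hη]
  rw [intervalIntegral.integral_const_mul, intervalIntegral.integral_comp_mul_right
    (fun σ : ℝ => ((σ - η.re / ‖η‖) ^ 2 + (|η.im| / ‖η‖) ^ 2) ^ (a / 2) - |σ| ^ a)
    (div_pos hr hρ).ne', neg_one_mul, one_mul, ← lineExcess, add_comm 1 a, rpow_add_one hρ.ne',
    smul_eq_mul, inv_div]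
  ring

lemma abs_two_sub_exp_neg_sub_le {A B : ℝ} (hA : |A| ≤ 1) (hB : |B| ≤ 1) :
    |(2 - rexp (-A) - rexp (-B)) - (A + B)| ≤ A ^ 2 + B ^ 2 := by
  have h1 := abs_le.1 (abs_exp_sub_one_sub_id_le (x := -A) (by rwa [abs_neg]))
  have h2 := abs_le.1 (abs_exp_sub_one_sub_id_le (x := -B) (by rwa [abs_neg]))
  rw [neg_sq] at h1 h2
  exact abs_le.2 ⟨by linarith, by linarith⟩

lemma exp_segmentMean_eq {a : ℝ} (h0 : 0 < a) (ρ : ℝ) (η : ℂ) :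
    rexp (-((1 + a) / 4) * segmentMean a ρ η) = rexp (-(1 / 4) * ‖η‖ ^ a) *
      rexp (-((1 + a) / 4 * (segmentMean a ρ η - ‖η‖ ^ a / (1 + a)))) := by
  have : (1 + a) ≠ 0 := by linarith
  rw [← Real.exp_add]
  congr 1
  field_simp
  ring

lemma abs_symm_diff_sub_le {a ρ : ℝ} (h0 : 0 < a) (h1 : a < 1) (hρ : 0 < ρ) (hρ1 : ρ ≤ 1) {η : ℂ}
    (hη : η ≠ 0) :
    |(2 * rexp (-(1 / 4) * ‖η‖ ^ a) - rexp (-((1 + a) / 4) * segmentMean a ρ η) -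
          rexp (-((1 + a) / 4) * segmentMean a ρ (-η))) / ρ ^ (1 + a) -
        rexp (-(1 / 4) * ‖η‖ ^ a) * ((1 + a) / 4 *
          (lineExcess a (η.re / ‖η‖) (|η.im| / ‖η‖) (‖η‖ / ρ) / ‖η‖))| ≤
      2 / a ^ 2 * (‖η‖ ^ (2 * a - 2) * rexp (-(1 / 4) * ‖η‖ ^ a)) * ρ ^ (1 - a) := by
  have hr : 0 < ‖η‖ := norm_pos_iff.2 hη
  have hbound : ∀ ξ : ℂ, ξ ≠ 0 → ‖ξ‖ = ‖η‖ →
      |(1 + a) / 4 * (segmentMean a ρ ξ - ‖η‖ ^ a / (1 + a))| ≤ 1 ∧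
      ((1 + a) / 4 * (segmentMean a ρ ξ - ‖η‖ ^ a / (1 + a))) ^ 2 ≤
        (ρ * ‖η‖ ^ (a - 1) / a) ^ 2 := by
    intro ξ hξ hn
    have e1 := abs_segmentMean_sub_le_rpow h0 h1 hρ.le ξ
    have e2 := abs_segmentMean_sub_le_mul h0 h1 hρ.le hξ
    have e3 : ρ ^ a ≤ 1 := rpow_le_one hρ.le hρ1 h0.le
    rw [hn] at e1 e2
    have e4 : |(1 + a) / 4 * (segmentMean a ρ ξ - ‖η‖ ^ a / (1 + a))| ≤
        |segmentMean a ρ ξ - ‖η‖ ^ a / (1 + a)| := by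
      rw [abs_mul, abs_of_pos (by linarith : 0 < (1 + a) / 4)]
      exact mul_le_of_le_one_left (abs_nonneg _) (by linarith)
    exact ⟨e4.trans (e1.trans e3), sq_le_sq' (abs_le.1 (e4.trans e2)).1 (abs_le.1 (e4.trans e2)).2⟩
  obtain ⟨hA, hA2⟩ := hbound η hη rfl
  obtain ⟨hB, hB2⟩ := hbound (-η) (neg_ne_zero.2 hη) (norm_neg η)
  have hsum := segmentMean_add_neg h0 hρ hη
  have hEB := exp_segmentMean_eq h0 ρ (-η)
  rw [norm_neg] at hEB
  rw [exp_segmentMean_eq h0 ρ η, hEB]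
  have hρa : 0 < ρ ^ (1 + a) := by positivity
  set A := (1 + a) / 4 * (segmentMean a ρ η - ‖η‖ ^ a / (1 + a)) with hAdef
  set B := (1 + a) / 4 * (segmentMean a ρ (-η) - ‖η‖ ^ a / (1 + a)) with hBdef
  set N := lineExcess a (η.re / ‖η‖) (|η.im| / ‖η‖) (‖η‖ / ρ) / ‖η‖
  set e := rexp (-(1 / 4) * ‖η‖ ^ a) with he
  have hAB : A + B = ρ ^ (1 + a) * ((1 + a) / 4 * N) := by
    rw [hAdef, hBdef, ← mul_add, hsum]; ring
  have hexpand : (2 * e - e * rexp (-A) - e * rexp (-B)) / ρ ^ (1 + a) - e * ((1 + a) / 4 * N) =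
      e * ((2 - rexp (-A) - rexp (-B)) - (A + B)) / ρ ^ (1 + a) := by
    rw [hAB]; field_simp
  have he0 : 0 < e := Real.exp_pos _
  rw [hexpand, abs_div, abs_mul, abs_of_pos he0, abs_of_pos hρa, div_le_iff₀ hρa]
  calc e * |(2 - rexp (-A) - rexp (-B)) - (A + B)|
      ≤ e * ((ρ * ‖η‖ ^ (a - 1) / a) ^ 2 + (ρ * ‖η‖ ^ (a - 1) / a) ^ 2) := by
        gcongr
        exact (abs_two_sub_exp_neg_sub_le hA hB).trans (add_le_add hA2 hB2)
    _ = 2 / a ^ 2 * (‖η‖ ^ (2 * a - 2) * e) * ρ ^ (1 - a) * ρ ^ (1 + a) := by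
        have e1 : ρ ^ (1 - a) * ρ ^ (1 + a) = ρ ^ 2 := by
          rw [← rpow_add hρ, ← rpow_natCast]; congr 1; push_cast; ring
        have e2 : ‖η‖ ^ (2 * a - 2) = (‖η‖ ^ (a - 1)) ^ 2 := by
          rw [← rpow_natCast, ← rpow_mul hr.le]; congr 1; push_cast; ring
        rw [mul_assoc _ (ρ ^ (1 - a)), e1, e2]
        ring

lemma abs_re_div_norm_le_one (η : ℂ) : |η.re / ‖η‖| ≤ 1 := by
  rw [abs_div, abs_norm]
  exact div_le_one_of_le₀ (Complex.abs_re_le_norm η) (norm_nonneg _)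

lemma abs_im_div_norm_le_one (η : ℂ) : |η.im| / ‖η‖ ≤ 1 :=
  div_le_one_of_le₀ (Complex.abs_im_le_norm η) (norm_nonneg _)

lemma integrable_exp_segmentMean {a ρ : ℝ} (h0 : 0 < a) (h1 : a < 1) (hρ : 0 ≤ ρ) :
    Integrable fun η : ℂ => rexp (-((1 + a) / 4) * segmentMean a ρ η) := by
  have hi := (integrable_norm_rpow_mul_exp_neg (k := 0) (by norm_num) h0
    (by norm_num : (0 : ℝ) < 1 / 4)).const_mul (rexp (ρ ^ a))
  refine hi.mono' ((continuous_const.mul (continuous_segmentMean h0 ρ)).rexp.aestronglyMeasurable)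
    (ae_of_all _ fun η => ?_)
  rw [norm_of_nonneg (Real.exp_pos _).le, exp_segmentMean_eq h0, rpow_zero, one_mul, mul_comm]
  gcongr
  have e := (abs_le.1 (abs_segmentMean_sub_le_rpow h0 h1 hρ η)).1
  have : 0 ≤ ρ ^ a := rpow_nonneg hρ a
  nlinarith

lemma tendsto_integral_symm_diff {a : ℝ} (h0 : 0 < a) (h1 : a < 1) :
    Tendsto (fun ρ : ℝ => ∫ η : ℂ,
        (2 * rexp (-(1 / 4) * ‖η‖ ^ a) - rexp (-((1 + a) / 4) * segmentMean a ρ η) -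
          rexp (-((1 + a) / 4) * segmentMean a ρ (-η))) / ρ ^ (1 + a))
      (nhdsWithin 0 (Set.Ioi 0))
      (nhds (∫ η : ℂ, rexp (-(1 / 4) * ‖η‖ ^ a) * ((1 + a) / 4 *
        (((|η.im| / ‖η‖) ^ (1 + a) * ∫ σ, rpowExcess a 1 σ) / ‖η‖)))) := by
  set c := ∫ σ, rpowExcess a 1 σ with hc
  have hc0 : 0 ≤ c := integral_nonneg fun σ => rpowExcess_nonneg h0 _ _
  have hsmall : ∀ᶠ ρ : ℝ in nhdsWithin 0 (Set.Ioi 0), 0 < ρ ∧ ρ ≤ 1 := by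
    filter_upwards [Ioc_mem_nhdsGT (zero_lt_one' ℝ)] with ρ hρ using hρ
  refine tendsto_integral_filter_of_dominated_convergence
    (fun η : ℂ => (1 + a) / 4 * (c + 1) * (‖η‖ ^ (-1 : ℝ) * rexp (-(1 / 4) * ‖η‖ ^ a)) +
      2 / a ^ 2 * (‖η‖ ^ (2 * a - 2) * rexp (-(1 / 4) * ‖η‖ ^ a))) ?_ ?_ ?_ ?_
  · refine Eventually.of_forall fun ρ => Continuous.aestronglyMeasurable ?_
    have hcont := continuous_segmentMean h0 ρ
    have hr : Continuous fun η : ℂ => ‖η‖ ^ a :=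
      continuous_norm.rpow_const fun _ => Or.inr h0.le
    fun_prop
  · filter_upwards [hsmall] with ρ hρ
    filter_upwards [volume.ae_ne (0 : ℂ)] with η hη
    have hr : 0 < ‖η‖ := norm_pos_iff.2 hη
    have h := abs_symm_diff_sub_le h0 h1 hρ.1 hρ.2 hη
    have hN := abs_lineExcess_le h0 h1 (abs_re_div_norm_le_one η) (by positivity)
      (abs_im_div_norm_le_one η) (div_pos hr hρ.1).le
    rw [← hc] at hN
    have hρ1 : ρ ^ (1 - a) ≤ 1 := rpow_le_one hρ.1.le hρ.2 (by linarith)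
    set e := rexp (-(1 / 4) * ‖η‖ ^ a)
    set N := lineExcess a (η.re / ‖η‖) (|η.im| / ‖η‖) (‖η‖ / ρ)
    have he0 : 0 < e := Real.exp_pos _
    have hmain : |e * ((1 + a) / 4 * (N / ‖η‖))| ≤
        (1 + a) / 4 * (c + 1) * (‖η‖ ^ (-1 : ℝ) * e) := by
      rw [abs_mul e, abs_of_pos he0, abs_mul ((1 + a) / 4),
        abs_of_pos (by linarith : 0 < (1 + a) / 4), abs_div N, abs_norm, rpow_neg_one]
      calc e * ((1 + a) / 4 * (|N| / ‖η‖)) ≤ e * ((1 + a) / 4 * ((c + 1) / ‖η‖)) := by gcongr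
        _ = _ := by ring
    have hrem : 2 / a ^ 2 * (‖η‖ ^ (2 * a - 2) * e) * ρ ^ (1 - a) ≤
        2 / a ^ 2 * (‖η‖ ^ (2 * a - 2) * e) :=
      mul_le_of_le_one_right (by positivity) hρ1
    rw [norm_eq_abs]
    have htri := (abs_sub_abs_le_abs_sub _ _).trans (h.trans hrem)
    linarith
  · exact ((integrable_norm_rpow_mul_exp_neg (by norm_num) h0 (by norm_num)).const_mul _).add
      ((integrable_norm_rpow_mul_exp_neg (by linarith) h0 (by norm_num)).const_mul _)
  · filter_upwards [volume.ae_ne (0 : ℂ)] with η hη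
    have hr : 0 < ‖η‖ := norm_pos_iff.2 hη
    have hT : Tendsto (fun ρ : ℝ => ‖η‖ / ρ) (nhdsWithin 0 (Set.Ioi 0)) atTop :=
      tendsto_inv_nhdsGT_zero.const_mul_atTop hr
    have hlim := ((((tendsto_lineExcess h0 h1 (abs_re_div_norm_le_one η)
      (by positivity : 0 ≤ |η.im| / ‖η‖)).comp hT).div_const ‖η‖).const_mul
        ((1 + a) / 4)).const_mul (rexp (-(1 / 4) * ‖η‖ ^ a))
    have hzero : Tendsto (fun ρ : ℝ =>
        2 / a ^ 2 * (‖η‖ ^ (2 * a - 2) * rexp (-(1 / 4) * ‖η‖ ^ a)) * ρ ^ (1 - a))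
        (nhdsWithin 0 (Set.Ioi 0)) (nhds 0) := by
      have hpow : Tendsto (fun ρ : ℝ => ρ ^ (1 - a)) (nhdsWithin 0 (Set.Ioi 0)) (nhds 0) := by
        have := (continuousAt_rpow_const 0 (1 - a) (Or.inr (by linarith))).tendsto
        rw [zero_rpow (by linarith)] at this
        exact this.mono_left nhdsWithin_le_nhds
      simpa using hpow.const_mul (2 / a ^ 2 * (‖η‖ ^ (2 * a - 2) * rexp (-(1 / 4) * ‖η‖ ^ a)))
    have hdiff := squeeze_zero_norm' (by
      filter_upwards [hsmall] with ρ hρ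
      rw [norm_eq_abs]
      exact abs_symm_diff_sub_le h0 h1 hρ.1 hρ.2 hη) hzero
    have := hdiff.add hlim
    rw [zero_add] at this
    refine this.congr fun ρ => ?_
    simp only [Function.comp]
    ring

lemma integral_angular_weight {a : ℝ} (h0 : 0 < a) (c : ℝ) :
    ∫ η : ℂ, rexp (-(1 / 4) * ‖η‖ ^ a) * ((1 + a) / 4 *
        (((|η.im| / ‖η‖) ^ (1 + a) * c) / ‖η‖)) =
      (1 + a) / 4 * c * ((1 / 4) ^ (-1 / a) * (1 / a) * Gamma (1 / a)) *
        (2 * √π * Gamma (1 + a / 2) / Gamma (a / 2 + 3 / 2)) := by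
  rw [integral_polar_separated (fun r => (1 + a) / 4 * c * (rexp (-(1 / 4) * r ^ a) / r))
    (fun θ => |Real.sin θ| ^ (1 + a)) (fun r θ hr => by
      rw [norm_polar hr, im_polar, abs_mul, abs_of_pos hr, mul_div_cancel_left₀ _ hr.ne']
      ring), integral_abs_sin_rpow (by linarith)]
  have h : ∀ r ∈ Set.Ioi (0 : ℝ), r * ((1 + a) / 4 * c * (rexp (-(1 / 4) * r ^ a) / r)) =
      (1 + a) / 4 * c * (r ^ (0 : ℝ) * rexp (-(1 / 4) * r ^ a)) := by
    intro r hr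
    have : r ≠ 0 := ne_of_gt hr
    rw [rpow_zero]
    field_simp
  rw [setIntegral_congr_fun measurableSet_Ioi h, integral_const_mul,
    integral_rpow_mul_exp_neg_mul_rpow h0 (by norm_num) (by norm_num), zero_add]
  ring_nf

lemma tendsto_integral_exp_segmentMean {a : ℝ} (h0 : 0 < a) (h1 : a < 1) :
    Tendsto (fun ρ : ℝ => ((∫ η : ℂ, rexp (-(1 / 4) * ‖η‖ ^ a)) -
        ∫ η : ℂ, rexp (-((1 + a) / 4) * segmentMean a ρ η)) / ρ ^ (1 + a))
      (nhdsWithin 0 (Set.Ioi 0))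
      (nhds (1 / 2 * ((1 + a) / 4 *
        (a / (1 + a) * (√π * Gamma (1 / 2 - a / 2) / Gamma (1 - a / 2))) *
        ((1 / 4) ^ (-1 / a) * (1 / a) * Gamma (1 / a)) *
        (2 * √π * Gamma (1 + a / 2) / Gamma (a / 2 + 3 / 2))))) := by
  have h := (tendsto_integral_symm_diff h0 h1).const_mul (1 / 2)
  rw [integral_angular_weight h0, integral_rpowExcess_one h0 h1] at h
  refine h.congr' ?_
  filter_upwards [self_mem_nhdsWithin] with ρ hρ
  have hρ : 0 < ρ := hρ
  have hi0 : Integrable fun η : ℂ => rexp (-(1 / 4) * ‖η‖ ^ a) := by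
    simpa using integrable_norm_rpow_mul_exp_neg (k := 0) (by norm_num) h0
      (by norm_num : (0 : ℝ) < 1 / 4)
  have hi := integrable_exp_segmentMean h0 h1 hρ.le
  have hi1 : Integrable fun η : ℂ =>
      2 * rexp (-(1 / 4) * ‖η‖ ^ a) - rexp (-((1 + a) / 4) * segmentMean a ρ η) :=
    (hi0.const_mul 2).sub hi
  rw [integral_div, integral_sub hi1 hi.comp_neg,
    integral_sub (hi0.const_mul 2) hi, integral_const_mul,
    integral_neg_eq_self (fun η : ℂ => rexp (-((1 + a) / 4) * segmentMean a ρ η))]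
  ring

lemma exists_linearIsometryEquiv_map_norm (w : EuclideanSpace ℝ (Fin 2)) :
    ∃ L : ℂ ≃ₗᵢ[ℝ] EuclideanSpace ℝ (Fin 2), L (‖w‖ : ℂ) = w := by
  let L₀ := Complex.orthonormalBasisOneI.repr
  have hn : ‖L₀ (‖w‖ : ℂ)‖ = ‖w‖ := by
    rw [LinearIsometryEquiv.norm_map, Complex.norm_real, norm_norm]
  exact ⟨L₀.trans (ℝ ∙ (L₀ (‖w‖ : ℂ) - w))ᗮ.reflection, Submodule.reflection_sub hn⟩

lemma integral_euclidean_eq_segmentMean (a b : ℝ) (w : EuclideanSpace ℝ (Fin 2)) :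
    ∫ η : EuclideanSpace ℝ (Fin 2), rexp (b * ∫ s in (0 : ℝ)..1, ‖w - s • η‖ ^ a) =
      ∫ η : ℂ, rexp (b * segmentMean a ‖w‖ η) := by
  obtain ⟨L, hL⟩ := exists_linearIsometryEquiv_map_norm w
  rw [← L.measurePreserving.integral_comp L.toHomeomorph.measurableEmbedding]
  refine integral_congr_ae (ae_of_all _ fun η => ?_)
  simp only [segmentMean]
  congr 2
  refine intervalIntegral.integral_congr fun s _ => ?_
  rw [← LinearIsometryEquiv.norm_map L ((‖w‖ : ℂ) - s • η), map_sub, map_smul, hL]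

lemma exp_segmentMean_zero {a : ℝ} (h0 : 0 < a) (η : ℂ) :
    rexp (-((1 + a) / 4) * segmentMean a 0 η) = rexp (-(1 / 4) * ‖η‖ ^ a) := by
  have h := segmentMean_sub_eq h0 0 η
  have hz : ∀ s : ℝ, ‖((0 : ℝ) : ℂ) - s • η‖ ^ a - |s| ^ a * ‖η‖ ^ a = 0 := by
    intro s
    rw [Complex.ofReal_zero, zero_sub, norm_neg, norm_smul, mul_rpow (norm_nonneg _) (norm_nonneg _),
      norm_eq_abs, sub_self]
  simp only [hz, intervalIntegral.integral_zero] at h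
  rw [exp_segmentMean_eq h0, h, mul_zero, neg_zero, Real.exp_zero, mul_one]

/-- For `α ∈ (0,1)` let
`Φ_α(ζ) = (1/(2π)²) ∫_{ℝ²} exp(-((1+α)/4) ∫_0^1 |(1+α)^{-1/α} ζ - s η|^α ds) dη`. Then
`Φ_α(0) = 2^{4/α} Γ(2/α)/(2πα)` and
`lim_{ζ→0, ζ≠0} (Φ_α(0) - Φ_α(ζ))/|ζ|^{α+1} = Φ_α(0) r_α`, where
`r_α = (α/(2^{2+2/α}(1+α)^{1/α+2})) Γ(1/α)Γ(1/2-α/2)Γ(1+α/2)/(Γ(2/α)Γ(1/2+α/2)Γ(1-α/2))`. -/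
theorem stmt14 (α : ℝ) (h0 : 0 < α) (h1 : α < 1)
    (Φ : EuclideanSpace ℝ (Fin 2) → ℝ)
    (hΦ : ∀ ζ, Φ ζ = (1 / (2 * π) ^ 2) * ∫ η : EuclideanSpace ℝ (Fin 2),
      Real.exp (-((1 + α) / 4) *
        ∫ s in (0:ℝ)..1, ‖((1 + α) ^ (-1 / α) : ℝ) • ζ - s • η‖ ^ α)) :
    Φ 0 = 2 ^ (4 / α) * Real.Gamma (2 / α) / (2 * π * α) ∧
    Tendsto (fun ζ : EuclideanSpace ℝ (Fin 2) => (Φ 0 - Φ ζ) / ‖ζ‖ ^ (α + 1))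
      (nhdsWithin 0 {(0 : EuclideanSpace ℝ (Fin 2))}ᶜ)
      (nhds (Φ 0 * ((α / (2 ^ (2 + 2 / α) * (1 + α) ^ (1 / α + 2))) *
        (Real.Gamma (1 / α) * Real.Gamma (1 / 2 - α / 2) * Real.Gamma (1 + α / 2)) /
        (Real.Gamma (2 / α) * Real.Gamma (1 / 2 + α / 2) * Real.Gamma (1 - α / 2))))) := by
  have hpos : 0 < 1 + α := by linarith
  set k : ℝ := (1 + α) ^ (-1 / α) with hk
  have hk0 : 0 < k := rpow_pos_of_pos hpos _
  have hΦ' : ∀ ζ, Φ ζ = (1 / (2 * π) ^ 2) *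
      ∫ η : ℂ, rexp (-((1 + α) / 4) * segmentMean α (k * ‖ζ‖) η) := by
    intro ζ
    rw [hΦ, integral_euclidean_eq_segmentMean, norm_smul, norm_of_nonneg hk0.le]
  have hzero : Φ 0 = (1 / (2 * π) ^ 2) * ∫ η : ℂ, rexp (-(1 / 4) * ‖η‖ ^ α) := by
    rw [hΦ', norm_zero, mul_zero]
    simp_rw [exp_segmentMean_zero h0]
  have hquarter : ∀ x : ℝ, (1 / 4 : ℝ) ^ (-x / α) = 2 ^ (2 * x / α) := by
    intro x
    rw [show (1 / 4 : ℝ) = 2 ^ (-2 : ℝ) by rw [rpow_neg two_pos.le, rpow_two]; norm_num,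
      ← rpow_mul two_pos.le]
    congr 1
    ring
  have hval : Φ 0 = 2 ^ (4 / α) * Real.Gamma (2 / α) / (2 * π * α) := by
    have h := integral_norm_rpow_mul_exp_neg (k := 0) (by norm_num) h0
      (by norm_num : (0 : ℝ) < 1 / 4)
    simp only [rpow_zero, one_mul, zero_add] at h
    rw [hzero, h, hquarter 2]
    have := pi_pos
    norm_num
    field_simp
  refine ⟨hval, ?_⟩
  have hscale : Tendsto (fun ζ : EuclideanSpace ℝ (Fin 2) => k * ‖ζ‖)
      (nhdsWithin 0 {(0 : EuclideanSpace ℝ (Fin 2))}ᶜ) (nhdsWithin 0 (Set.Ioi 0)) := by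
    refine tendsto_nhdsWithin_iff.2 ⟨?_, ?_⟩
    · have : Tendsto (fun ζ : EuclideanSpace ℝ (Fin 2) => k * ‖ζ‖) (nhds 0) (nhds (k * ‖(0 :
          EuclideanSpace ℝ (Fin 2))‖)) := (continuous_const.mul continuous_norm).tendsto 0
      rw [norm_zero, mul_zero] at this
      exact this.mono_left nhdsWithin_le_nhds
    · filter_upwards [self_mem_nhdsWithin] with ζ hζ
      exact mul_pos hk0 (norm_pos_iff.2 hζ)
  have hlim := ((tendsto_integral_exp_segmentMean h0 h1).comp hscale).const_mul
    (1 / (2 * π) ^ 2 * k ^ (1 + α))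
  have hconst : 1 / (2 * π) ^ 2 * k ^ (1 + α) * (1 / 2 * ((1 + α) / 4 *
        (α / (1 + α) * (√π * Gamma (1 / 2 - α / 2) / Gamma (1 - α / 2))) *
        ((1 / 4) ^ (-1 / α) * (1 / α) * Gamma (1 / α)) *
        (2 * √π * Gamma (1 + α / 2) / Gamma (α / 2 + 3 / 2)))) =
      Φ 0 * ((α / (2 ^ (2 + 2 / α) * (1 + α) ^ (1 / α + 2))) *
        (Real.Gamma (1 / α) * Real.Gamma (1 / 2 - α / 2) * Real.Gamma (1 + α / 2)) /
        (Real.Gamma (2 / α) * Real.Gamma (1 / 2 + α / 2) * Real.Gamma (1 - α / 2))) := by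
    have g1 : Gamma (α / 2 + 3 / 2) = (1 + α) / 2 * Gamma (1 / 2 + α / 2) := by
      rw [show α / 2 + 3 / 2 = (1 / 2 + α / 2) + 1 by ring, Gamma_add_one (by linarith)]
      ring
    have g2 : 0 < Gamma (2 / α) := Gamma_pos_of_pos (by positivity)
    have g3 : 0 < Gamma (1 / 2 + α / 2) := Gamma_pos_of_pos (by positivity)
    have g4 : 0 < Gamma (1 - α / 2) := Gamma_pos_of_pos (by linarith)
    have p1 : k ^ (1 + α) * (1 + α) ^ (1 / α + 2) = 1 + α := by
      rw [hk, ← rpow_mul hpos.le, ← rpow_add hpos]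
      refine Eq.trans ?_ (rpow_one (1 + α))
      congr 1
      field_simp
      ring
    have p2 : (2 : ℝ) ^ (4 / α) = 2 ^ (2 / α) * 2 ^ (2 / α) := by
      rw [← rpow_add two_pos]
      congr 1
      ring
    have p3 : (2 : ℝ) ^ (2 + 2 / α) = 4 * 2 ^ (2 / α) := by
      rw [rpow_add two_pos, rpow_two]
      norm_num
    have p4 : 0 < (1 + α) ^ (1 / α + 2) := by positivity
    have p5 : k ^ (1 + α) = (1 + α) / (1 + α) ^ (1 / α + 2) := by
      rw [eq_div_iff p4.ne', p1]
    have p6 : (0 : ℝ) < 2 ^ (2 / α) := by positivity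
    have hπ : √π * √π = π := mul_self_sqrt pi_pos.le
    have hπ0 := pi_pos
    rw [hval, g1, p5, hquarter 1, mul_one, p2, p3]
    calc _ = √π * √π * (1 / (2 * π) ^ 2 * ((1 + α) / (1 + α) ^ (1 / α + 2)) * (1 / 2 *
          ((1 + α) / 4 * (α / (1 + α) * (Gamma (1 / 2 - α / 2) / Gamma (1 - α / 2))) *
          (2 ^ (2 / α) * (1 / α) * Gamma (1 / α)) *
          (2 * Gamma (1 + α / 2) / ((1 + α) / 2 * Gamma (1 / 2 + α / 2)))))) := by ring
      _ = _ := by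
        rw [hπ]
        field_simp
  rw [← hconst]
  refine hlim.congr' ?_
  filter_upwards [self_mem_nhdsWithin] with ζ hζ
  have hζ0 : 0 < ‖ζ‖ := norm_pos_iff.2 hζ
  simp only [Function.comp]
  rw [hzero, hΦ' ζ, mul_rpow hk0.le hζ0.le, add_comm α 1]
  have h2 : 0 < k ^ (1 + α) := by positivity
  have h3 : 0 < ‖ζ‖ ^ (1 + α) := by positivity
  field_simp
end
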